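/- Let F be a dominated varying distribution on the nonnegative integers satisfying condition (C). Assume Eξ² < ∞ and that F is x^γ-insensitive for some γ > 1/2. Then, uniformly in n ≥ 1, P{W_n > x} ~ Σ_{i=0}^{n-1} m^i·F̄(m^{i+1}x) as x → ∞; moreover P{W_n > x} ~ Σ_{i=0}^{∞} m^i·F̄(m^{i+1}x) as x, n → ∞, and P{W > x} ~ Σ_{i=0}^{∞} m^i·F̄(m^{i+1}x) as x → ∞. -/

import Mathlib

open MeasureTheory Filter ProbabilityTheory

structure GWTail (F : ℝ → ℝ) (m g : ℝ) : Prop where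
  anti : Antitone F
  pos : ∀ x, 0 < F x
  one_lt : 1 < m
  g_half : 1 / 2 < g
  g_one : g < 1
  ins : ∀ c ≥ (0:ℝ), ∀ ε > (0:ℝ), ∃ X : ℝ, ∀ y ≥ X,
    F (y - c * y ^ g) ≤ (1 + ε) * F y ∧ (1 - ε) * F y ≤ F (y + c * y ^ g)
  dv : ∀ r ≥ (1:ℝ), ∃ D > (0:ℝ), ∀ x ≥ (0:ℝ), F (x / r) ≤ D * F x
  tail : ∃ ρ > (0:ℝ), ρ < 1 ∧ ∃ c > (0:ℝ), ∀ x > (1:ℝ), ∀ i : ℕ,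
    m ^ i * F (m ^ (i + 1) * x) ≤ c * ρ ^ i * F x
  lim : Tendsto F atTop (nhds 0)
  pow_lower : ∃ p > (0:ℝ), ∃ c > (0:ℝ), ∀ t ≥ (1:ℝ), c * t ^ (-p) ≤ F t

theorem gwtail_of (F : ℝ → ℝ) (m γ : ℝ) (anti : Antitone F) (hm : 1 < m)
    (nonneg : ∀ x, 0 ≤ F x)
    (hDV : ∃ C : ℝ, ∀ x : ℝ, F (x / 2) ≤ C * F x)
    (hC : ∃ δ > (0 : ℝ), ∃ c : ℝ, ∀ x > (1 : ℝ), ∀ y > (1 : ℝ),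
      F (x * y) ≤ c * F x / y ^ (1 + δ))
    (hγ : 1 / 2 < γ)
    (hins : Tendsto (fun x : ℝ => F (x + x ^ γ) / F x) atTop (nhds 1)) :
    ∃ g, GWTail F m g := by
  have pos : ∀ x, 0 < F x := by
    intro x
    have h1 : ∀ᶠ y in atTop, (0:ℝ) < F (y + y ^ γ) / F y :=
      hins.eventually (lt_mem_nhds one_pos)
    obtain ⟨y, hy, hxy⟩ := (h1.and (eventually_ge_atTop x)).exists
    have : F y ≠ 0 := by
      intro h0
      simp [h0] at hy
    exact lt_of_lt_of_le (lt_of_le_of_ne (nonneg y) this.symm) (anti hxy)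
  obtain ⟨g, hg1, hg2⟩ : ∃ g, 1/2 < g ∧ g < min γ 1 := exists_between (by
    rw [lt_min_iff]; constructor <;> linarith)
  have hgγ : g < γ := lt_of_lt_of_le hg2 (min_le_left _ _)
  have hg1' : g < 1 := lt_of_lt_of_le hg2 (min_le_right _ _)
  obtain ⟨C0, hC0⟩ := hDV
  obtain ⟨C, hCge, hCx⟩ : ∃ C ≥ (2:ℝ), ∀ x : ℝ, F (x / 2) ≤ C * F x := by
    refine ⟨max C0 2, le_max_right _ _, fun x => (hC0 x).trans ?_⟩
    exact mul_le_mul_of_nonneg_right (le_max_left _ _) (nonneg x)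
  have iter : ∀ (j : ℕ) (x : ℝ), F (x / 2 ^ j) ≤ C ^ j * F x := by
    intro j
    induction j with
    | zero => intro x; simp
    | succ j ih =>
      intro x
      calc F (x / 2 ^ (j+1)) = F ((x / 2 ^ j) / 2) := by congr 1; field_simp; ring
        _ ≤ C * F (x / 2 ^ j) := hCx _
        _ ≤ C * (C ^ j * F x) := by gcongr; exact ih x
        _ = _ := by ring
  have dom : ∀ c ≥ (0:ℝ), ∀ᶠ y : ℝ in atTop, c * y ^ g ≤ y ^ γ := by
    intro c hc
    have h := (tendsto_rpow_atTop (sub_pos.2 hgγ)).eventually_ge_atTop c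
    filter_upwards [h, eventually_gt_atTop 0] with y hy hy0
    calc c * y ^ g ≤ y ^ (γ - g) * y ^ g := by gcongr
      _ = y ^ γ := by rw [← Real.rpow_add hy0]; congr 1; ring
  have dom1 : ∀ c ≥ (0:ℝ), ∀ᶠ y : ℝ in atTop, c * y ^ g ≤ y := by
    intro c hc
    have h := (tendsto_rpow_atTop (sub_pos.2 hg1')).eventually_ge_atTop c
    filter_upwards [h, eventually_gt_atTop 0] with y hy hy0
    calc c * y ^ g ≤ y ^ (1 - g) * y ^ g := by gcongr
      _ = y := by rw [← Real.rpow_add hy0]; simp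
  obtain ⟨δ, hδ, c, hc⟩ := hC
  refine ⟨g, anti, pos, hm, hg1, hg1', ?_, ?_, ?_, ?_, ?_⟩
  · intro c hc ε hε
    rw [← Filter.eventually_atTop]
    refine Filter.Eventually.and ?_ ?_
    · -- z = y - c y^g
      have hz : Tendsto (fun y : ℝ => y - c * y ^ g) atTop atTop := by
        have h2 : Tendsto (fun y : ℝ => y / 2) atTop atTop := tendsto_id.atTop_div_const (by norm_num)
        refine tendsto_atTop_mono' _ ?_ h2
        filter_upwards [dom1 (2*c) (by positivity)] with y hy
        linarith
      have hr : ∀ᶠ z in atTop, (1 + ε)⁻¹ < F (z + z ^ γ) / F z :=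
        hins.eventually (lt_mem_nhds (inv_lt_one_of_one_lt₀ (by linarith)))
      filter_upwards [hz.eventually hr, dom1 (2*c) (by positivity), eventually_gt_atTop 0,
        dom (c * 2 ^ γ) (by positivity)] with y h1 h2 h3 h4
      have hzy : y / 2 ≤ y - c * y ^ g := by linarith
      have h5 : c * y ^ g ≤ (y - c * y ^ g) ^ γ := by
        calc c * y ^ g = (c * 2 ^ γ * y ^ g) / 2 ^ γ := by
              field_simp
          _ ≤ y ^ γ / 2 ^ γ := by gcongr
          _ = (y / 2) ^ γ := by rw [Real.div_rpow h3.le (by norm_num)]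
          _ ≤ _ := by apply Real.rpow_le_rpow (by positivity) hzy (by linarith)
      have h6 : F (y - c * y ^ g + (y - c * y ^ g) ^ γ) ≤ F y := anti (by linarith)
      rw [lt_div_iff₀ (pos _), inv_mul_lt_iff₀ (by linarith)] at h1
      nlinarith
    · have hr : ∀ᶠ z in atTop, (1 - ε) < F (z + z ^ γ) / F z :=
        hins.eventually (lt_mem_nhds (by linarith))
      filter_upwards [hr, dom c hc] with y h1 h2
      rw [lt_div_iff₀ (pos _)] at h1
      exact h1.le.trans (anti (by linarith))
  · intro r hr
    obtain ⟨j, hj⟩ := pow_unbounded_of_one_lt r (one_lt_two)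
    refine ⟨C ^ j, by positivity, fun x hx => le_trans (anti ?_) (iter j x)⟩
    gcongr
  · refine ⟨m ^ (-δ), by positivity, Real.rpow_lt_one_of_one_lt_of_neg hm (by linarith), max c 1, by positivity, ?_⟩
    intro x hx i
    have hm0 : 0 < m := by linarith
    have hy : 1 < m ^ (i+1) := one_lt_pow₀ hm (by omega)
    have h := hc x hx (m ^ (i+1)) hy
    rw [mul_comm x] at h
    have h2 : c * F x / (m ^ (i + 1)) ^ (1 + δ) ≤ (max c 1) * F x / (m ^ (i + 1)) ^ (1 + δ) := by
      have := nonneg x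
      gcongr
      exact le_max_left _ _
    have h3 : m ^ i * (max c 1 * F x / (m ^ (i + 1)) ^ (1 + δ)) ≤ max c 1 * (m ^ (-δ)) ^ i * F x := by
      have e1 : (m ^ (i + 1)) ^ (1 + δ) = m ^ (i + 1) * ((m ^ δ) ^ i * m ^ δ) := by
        rw [Real.rpow_add (by positivity), Real.rpow_one, ← Real.rpow_natCast m (i+1), ← Real.rpow_mul hm0.le, mul_comm _ δ, Real.rpow_mul hm0.le, Real.rpow_natCast, Real.rpow_natCast, pow_succ (m^δ) i]
      have e2 : m ^ (-δ) = (m ^ δ)⁻¹ := Real.rpow_neg hm0.le _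
      have e3 : 1 ≤ m * m ^ δ := by
        have := Real.one_le_rpow hm.le hδ.le
        nlinarith
      rw [e1, e2]
      have e4 : m ^ i * (max c 1 * F x / (m ^ (i + 1) * ((m ^ δ) ^ i * m ^ δ))) =
        (max c 1 * ((m ^ δ)⁻¹) ^ i * F x) / (m * m ^ δ) := by
        have hd : 0 < m ^ δ := by positivity
        generalize m ^ δ = d at hd
        rw [inv_pow]
        field_simp
        ring
      rw [e4]
      apply div_le_self _ e3
      have := nonneg x
      positivity
    refine le_trans ?_ h3
    gcongr
    exact h.trans h2
  · -- limit
    have h1 : Tendsto (fun x : ℝ => (c * F 2) * ((x/2) ^ (1 + δ))⁻¹) atTop (nhds ((c * F 2) * 0)) := by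
      apply Tendsto.const_mul
      apply Tendsto.inv_tendsto_atTop
      exact (tendsto_rpow_atTop (by linarith)).comp (tendsto_id.atTop_div_const (by norm_num))
    rw [mul_zero] at h1
    refine tendsto_of_tendsto_of_tendsto_of_le_of_le' tendsto_const_nhds h1 (Eventually.of_forall nonneg) ?_
    filter_upwards [eventually_gt_atTop 2] with x hx
    have := hc 2 (by norm_num) (x/2) (by linarith)
    rwa [mul_div_cancel₀ _ (by norm_num), div_eq_mul_inv] at this
  · refine ⟨Real.logb 2 C, Real.logb_pos (by norm_num) (by linarith), F 1 / C, div_pos (pos 1) (by linarith), ?_⟩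
    intro t ht
    have hC0 : 0 < C := by linarith
    set j := ⌈Real.logb 2 t⌉₊ with hj
    have hj1 : Real.logb 2 t ≤ j := Nat.le_ceil _
    have hl : 0 ≤ Real.logb 2 t := Real.logb_nonneg (by norm_num) ht
    have hj2 : (j:ℝ) ≤ Real.logb 2 t + 1 := (Nat.ceil_lt_add_one hl).le
    have ht2 : t ≤ 2 ^ j := by
      have := (Real.logb_le_iff_le_rpow (by norm_num : (1:ℝ) < 2) (by linarith)).1 hj1
      simpa using this
    have h1 : F 1 ≤ C ^ j * F t := (anti (by rw [div_le_one (by positivity)]; exact ht2)).trans (iter j t)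
    have h2 : C ^ j ≤ t ^ (Real.logb 2 C) * C := by
      rw [← Real.rpow_natCast]
      calc C ^ (j:ℝ) ≤ C ^ (Real.logb 2 t + 1) := Real.rpow_le_rpow_of_exponent_le (by linarith) hj2
        _ = C ^ (Real.logb 2 t) * C := by rw [Real.rpow_add hC0, Real.rpow_one]
        _ = _ := by
          congr 1
          conv_lhs => rw [← Real.rpow_logb (by norm_num : (0:ℝ) < 2) (by norm_num) hC0]
          conv_rhs => rw [← Real.rpow_logb (by norm_num : (0:ℝ) < 2) (by norm_num) (by linarith : 0 < t)]
          rw [← Real.rpow_mul (by norm_num), ← Real.rpow_mul (by norm_num), mul_comm]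
    rw [Real.rpow_neg (by linarith)]
    have : 0 < t ^ (Real.logb 2 C) := by positivity
    have hF := pos t
    rw [div_mul_eq_mul_div, div_le_iff₀ hC0, ← div_eq_mul_inv, div_le_iff₀ this]
    calc F 1 ≤ _ := h1
      _ ≤ (t ^ (Real.logb 2 C) * C) * F t := by gcongr
      _ = _ := by ring


structure GWStep (F : ℝ → ℝ) (m : ℝ) (G : ℕ → ℝ → ℝ) (V C x0 : ℝ) : Prop where
  anti : ∀ n, Antitone (G n)
  nonneg : ∀ n x, 0 ≤ G n x
  le_one : ∀ n x, G n x ≤ 1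
  zero : ∀ x ≥ (1:ℝ), G 0 x = 0
  V0 : 0 ≤ V
  C0 : 0 ≤ C
  U1 : ∀ n : ℕ, ∀ a b : ℝ, x0 ≤ b → a < b → G (n+1) b ≤ G n a + C * (m^n * F (m^(n+1) * b))
    + G n (b/2) * (b * V / (m^n * (b-a)^2))
  L1 : ∀ n : ℕ, ∀ a b : ℝ, 0 < a → a < b →
    G n b - G n b * (b * V / (m^n * (b-a)^2)) ≤ G (n+1) a
  U2 : ∀ n : ℕ, ∀ ε > (0:ℝ), ∃ X : ℝ, ∀ b ≥ X, ∀ a < b, G (n+1) b ≤ G n a +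
    (m^n + ε) * F (m^(n+1) * b) + G n (b/2) * (b * V / (m^n * (b-a)^2))
  L2 : ∀ n : ℕ, ∀ ε > (0:ℝ), ∃ X : ℝ, ∀ a ≥ X, ∀ b > a, (m^n - ε) * F (m^(n+1) * a) +
    (G n b - G n b * (b * V / (m^n * (b-a)^2))) ≤ G (n+1) a

theorem gw_e_bound (m g V : ℝ) (hm : 1 < m) (hg : g < 1) (hV : 0 ≤ V)
    (i : ℕ) (x b : ℝ) (hx : 1 ≤ x) (hb : b ≤ 2 * x) :
    b * V / (m^i * (x^g * (m^(g-1))^i * (1 - m^(g-1)))^2) ≤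
      (2 * V / (1 - m^(g-1))^2) * x^(1-2*g) * (m^(1-2*g))^i := by
  have hm0 : 0 < m := by linarith
  have hx0 : 0 < x := by linarith
  have hq : m^(g-1) < 1 := Real.rpow_lt_one_of_one_lt_of_neg hm (by linarith)
  have e1 : m^(1-2*g) = (m * (m^(g-1))^2)⁻¹ := by
    rw [← Real.rpow_natCast (m^(g-1)) 2, ← Real.rpow_mul hm0.le]
    nth_rewrite 2 [← Real.rpow_one m]
    rw [← Real.rpow_add hm0, ← Real.rpow_neg hm0.le]
    congr 1; push_cast; ring
  have e2 : x^(1-2*g) = x * ((x^g)^2)⁻¹ := by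
    rw [← Real.rpow_natCast (x^g) 2, ← Real.rpow_mul hx0.le, ← Real.rpow_neg hx0.le]
    nth_rewrite 2 [← Real.rpow_one x]
    rw [← Real.rpow_add hx0]
    congr 1; push_cast; ring
  have hq0 : 0 < m^(g-1) := by positivity
  have hxg : 0 < x^g := by positivity
  rw [e1, e2]
  generalize m^(g-1) = q at hq hq0
  generalize x^g = y at hxg
  have h1 : 0 < 1 - q := by linarith
  calc b * V / (m^i * (y * q^i * (1 - q))^2) ≤ (2*x) * V / (m^i * (y * q^i * (1 - q))^2) := by gcongr
    _ = _ := by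
      rw [inv_pow, mul_pow, mul_pow, mul_pow, ← pow_mul q, ← pow_mul q, mul_comm i 2]
      field_simp

theorem gw_xg {F : ℝ → ℝ} {m g : ℝ} (hF : GWTail F m g) :
    ∀ᶠ y : ℝ in atTop, y ^ g ≤ y / 2 := by
  have h := (tendsto_rpow_atTop (sub_pos.2 hF.g_one)).eventually_ge_atTop 2
  filter_upwards [h, eventually_gt_atTop 0] with y hy hy0
  have : 2 * y ^ g ≤ y := by
    calc 2 * y ^ g ≤ y ^ (1 - g) * y ^ g := by gcongr
      _ = y := by rw [← Real.rpow_add hy0]; simp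
  linarith

theorem gw_small {F : ℝ → ℝ} {m g : ℝ} (hF : GWTail F m g) (K : ℝ) (ε : ℝ) (hε : 0 < ε) :
    ∀ᶠ y : ℝ in atTop, K * y ^ (1 - 2 * g) ≤ ε := by
  have h := (tendsto_rpow_neg_atTop (y := 2 * g - 1) (by linarith [hF.g_half])).const_mul K
  rw [mul_zero] at h
  filter_upwards [h.eventually (gt_mem_nhds hε)] with y hy
  rw [show 1 - 2 * g = -(2 * g - 1) by ring]
  exact hy.le

theorem gw_up {F : ℝ → ℝ} {m g : ℝ} (hF : GWTail F m g) {G : ℕ → ℝ → ℝ} {V C x0 : ℝ}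
    (hG : GWStep F m G V C x0) : ∃ K ≥ (0:ℝ), ∃ ρ > (0:ℝ), ρ < 1 ∧ ∃ X1 : ℝ, ∀ x ≥ X1,
    ∀ I n : ℕ, I ≤ n → ∀ M ≥ (0:ℝ), (∀ i < n, G i (x/4) ≤ M) →
    G n x ≤ G I (x - x^g) + K * ρ^I * F x + M * (K * x^(1-2*g)) := by
  obtain ⟨ρ, hρ0, hρ1, c, hc0, hc⟩ := hF.tail
  obtain ⟨D, hD0, hD⟩ := hF.dv 2 (by norm_num)
  have hm := hF.one_lt
  have hm0 : 0 < m := by linarith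
  have hg := hF.g_one
  set q := m^(g-1) with hqd
  set r := m^(1-2*g) with hrd
  have hq1 : q < 1 := Real.rpow_lt_one_of_one_lt_of_neg hm (by linarith)
  have hq0 : 0 < q := by positivity
  have hr1 : r < 1 := Real.rpow_lt_one_of_one_lt_of_neg hm (by linarith [hF.g_half])
  have hr0 : 0 < r := by positivity
  set K1 := 2 * V / (1 - q)^2 with hK1
  have hV0 := hG.V0
  have hC0 := hG.C0
  have hK10 : 0 ≤ K1 := by positivity
  have hr1' : 0 < 1 - r := by linarith
  have hρ1' : 0 < 1 - ρ := by linarith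
  refine ⟨C * c * D / (1 - ρ) + K1 / (1 - r), by positivity, ρ, hρ0, hρ1, ?_⟩
  rw [← Filter.eventually_atTop]
  filter_upwards [gw_xg hF, eventually_ge_atTop 4, eventually_ge_atTop (2 * x0)] with x hxg hx4 hx0
  intro I n hIn M hM hGM
  have hxg0 : 0 < x^g := Real.rpow_pos_of_pos (by linarith) _
  have hx1 : 0 < x^(1-2*g) := Real.rpow_pos_of_pos (by linarith) _
  have hqi : ∀ i : ℕ, q^i ≤ 1 := fun i => pow_le_one₀ hq0.le hq1.le
  have hui : ∀ i : ℕ, x / 2 ≤ x - x^g * q^i := fun i => by nlinarith [hqi i]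
  have hFx := hF.pos x
  have key : ∀ k : ℕ, I ≤ k → k ≤ n → G k (x - x^g * q^k) ≤ G I (x - x^g * q^I) +
      ∑ i ∈ Finset.Ico I k, ((C * c * D * F x) * ρ^i + (M * K1 * x^(1-2*g)) * r^i) := by
    intro k hk
    induction k, hk using Nat.le_induction with
    | base => intro _; simp
    | succ k hk ih =>
      intro hkn
      have h1 := ih (by omega)
      rw [Finset.sum_Ico_succ_top hk]
      have hpos : 0 < x^g * q^k * (1 - q) := by
        have : 0 < 1 - q := by linarith
        positivity
      have hdiff : (x - x^g * q^(k+1)) - (x - x^g * q^k) = x^g * q^k * (1 - q) := by ring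
      have h2 := hG.U1 k (x - x^g * q^k) (x - x^g * q^(k+1)) (by linarith [hui (k+1)]) (by linarith)
      rw [hdiff] at h2
      have h3 := gw_e_bound m g V hm hg hG.V0 k x (x - x^g * q^(k+1)) (by linarith) (by
        have : 0 < x^g * q^(k+1) := by positivity
        linarith)
      have h4 : G k ((x - x^g * q^(k+1))/2) ≤ M :=
        (hG.anti k (by linarith [hui (k+1)])).trans (hGM k (by omega))
      have h5 : m^k * F (m^(k+1) * (x - x^g * q^(k+1))) ≤ c * D * F x * ρ^k := by
        calc _ ≤ m^k * F (m^(k+1) * (x/2)) := by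
              gcongr
              exact hF.anti (by gcongr; exact hui _)
          _ ≤ c * ρ^k * F (x/2) := hc _ (by linarith) k
          _ ≤ c * ρ^k * (D * F x) := by gcongr; exact hD x (by linarith)
          _ = _ := by ring
      have h6 : G k ((x - x^g * q^(k+1))/2) * ((x - x^g * q^(k+1)) * V / (m^k * (x^g * q^k * (1 - q))^2))
        ≤ M * (K1 * x^(1-2*g) * r^k) := by
        apply mul_le_mul h4 h3 _ hM
        have := hui (k+1)
        have : 0 ≤ (x - x^g * q^(k+1)) := by linarith
        positivity
      have h7 := mul_le_mul_of_nonneg_left h5 hC0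
      linarith
  have h1 := key n hIn le_rfl
  rw [Finset.sum_add_distrib, ← Finset.mul_sum, ← Finset.mul_sum] at h1
  have s1 : ∑ i ∈ Finset.Ico I n, ρ^i ≤ ρ^I / (1 - ρ) := geom_sum_Ico_le_of_lt_one hρ0.le hρ1
  have s2 : ∑ i ∈ Finset.Ico I n, r^i ≤ 1 / (1 - r) := by
    refine (geom_sum_Ico_le_of_lt_one hr0.le hr1).trans ?_
    gcongr
    exact pow_le_one₀ hr0.le hr1.le
  have t1 := mul_le_mul_of_nonneg_left s1 (show 0 ≤ C * c * D * F x by positivity)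
  have t2 := mul_le_mul_of_nonneg_left s2 (show 0 ≤ M * K1 * x^(1-2*g) by positivity)
  have a1 : G n x ≤ G n (x - x^g * q^n) := hG.anti n (by
    have : 0 < x^g * q^n := by positivity
    linarith)
  have a2 : G I (x - x^g * q^I) ≤ G I (x - x^g) := hG.anti I (by nlinarith [hqi I])
  have f1 : 0 ≤ (K1 / (1 - r)) * ρ^I * F x := by positivity
  have f2 : 0 ≤ M * ((C * c * D / (1 - ρ)) * x^(1-2*g)) := by positivity
  have g1 : C * c * D * F x * (ρ^I / (1 - ρ)) = (C * c * D / (1 - ρ)) * ρ^I * F x := by ring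
  have g2 : M * K1 * x^(1-2*g) * (1 / (1 - r)) = M * ((K1 / (1 - r)) * x^(1-2*g)) := by ring
  rw [g1] at t1
  rw [g2] at t2
  linarith

theorem gw_low {F : ℝ → ℝ} {m g : ℝ} (hF : GWTail F m g) {G : ℕ → ℝ → ℝ} {V C x0 : ℝ}
    (hG : GWStep F m G V C x0) : ∃ K ≥ (0:ℝ), ∃ X1 : ℝ, ∀ x ≥ X1,
    ∀ I n : ℕ, I ≤ n → ∀ M ≥ (0:ℝ), (∀ i < n, G i x ≤ M) →
    G I (x + x^g) - M * (K * x^(1-2*g)) ≤ G n x := by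
  have hm := hF.one_lt
  have hm0 : 0 < m := by linarith
  have hg := hF.g_one
  set q := m^(g-1) with hqd
  set r := m^(1-2*g) with hrd
  have hq1 : q < 1 := Real.rpow_lt_one_of_one_lt_of_neg hm (by linarith)
  have hq0 : 0 < q := by positivity
  have hr1 : r < 1 := Real.rpow_lt_one_of_one_lt_of_neg hm (by linarith [hF.g_half])
  have hr0 : 0 < r := by positivity
  set K1 := 2 * V / (1 - q)^2 with hK1
  have hV0 := hG.V0
  have hK10 : 0 ≤ K1 := by positivity
  have hr1' : 0 < 1 - r := by linarith
  refine ⟨K1 / (1 - r), by positivity, ?_⟩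
  rw [← Filter.eventually_atTop]
  filter_upwards [gw_xg hF, eventually_ge_atTop 4] with x hxg hx4
  intro I n hIn M hM hGM
  have hxg0 : 0 < x^g := Real.rpow_pos_of_pos (by linarith) _
  have hx1 : 0 < x^(1-2*g) := Real.rpow_pos_of_pos (by linarith) _
  have hqi : ∀ i : ℕ, q^i ≤ 1 := fun i => pow_le_one₀ hq0.le hq1.le
  have hui : ∀ i : ℕ, x ≤ x + x^g * q^i := fun i => by
    have : 0 < x^g * q^i := by positivity
    linarith
  have key : ∀ k : ℕ, I ≤ k → k ≤ n → G I (x + x^g * q^I) -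
      ∑ i ∈ Finset.Ico I k, ((M * K1 * x^(1-2*g)) * r^i) ≤ G k (x + x^g * q^k) := by
    intro k hk
    induction k, hk using Nat.le_induction with
    | base => intro _; simp
    | succ k hk ih =>
      intro hkn
      have h1 := ih (by omega)
      rw [Finset.sum_Ico_succ_top hk]
      have hpos : 0 < x^g * q^k * (1 - q) := by
        have : 0 < 1 - q := by linarith
        positivity
      have hdiff : (x + x^g * q^k) - (x + x^g * q^(k+1)) = x^g * q^k * (1 - q) := by ring
      have h2 := hG.L1 k (x + x^g * q^(k+1)) (x + x^g * q^k) (by linarith [hui (k+1)]) (by linarith)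
      rw [hdiff] at h2
      have h3 := gw_e_bound m g V hm hg hG.V0 k x (x + x^g * q^k) (by linarith) (by
        nlinarith [hqi k])
      have h4 : G k (x + x^g * q^k) ≤ M :=
        (hG.anti k (hui k)).trans (hGM k (by omega))
      have h6 : G k (x + x^g * q^k) * ((x + x^g * q^k) * V / (m^k * (x^g * q^k * (1 - q))^2))
        ≤ M * (K1 * x^(1-2*g) * r^k) := by
        apply mul_le_mul h4 h3 _ hM
        have : 0 ≤ (x + x^g * q^k) := by linarith [hui k]
        positivity
      linarith
  have h1 := key n hIn le_rfl
  rw [← Finset.mul_sum] at h1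
  have s2 : ∑ i ∈ Finset.Ico I n, r^i ≤ 1 / (1 - r) := by
    refine (geom_sum_Ico_le_of_lt_one hr0.le hr1).trans ?_
    gcongr
    exact pow_le_one₀ hr0.le hr1.le
  have t2 := mul_le_mul_of_nonneg_left s2 (show 0 ≤ M * K1 * x^(1-2*g) by positivity)
  have a1 : G n (x + x^g * q^n) ≤ G n x := hG.anti n (hui n)
  have a2 : G I (x + x^g) ≤ G I (x + x^g * q^I) := hG.anti I (by nlinarith [hqi I])
  have g2 : M * K1 * x^(1-2*g) * (1 / (1 - r)) = M * ((K1 / (1 - r)) * x^(1-2*g)) := by ring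
  rw [g2] at t2
  linarith

theorem gw_crude {F : ℝ → ℝ} {m g : ℝ} (hF : GWTail F m g) {G : ℕ → ℝ → ℝ} {V C x0 : ℝ}
    (hG : GWStep F m G V C x0) : ∃ A > (0:ℝ), ∀ n x, G n x ≤ A * F x := by
  obtain ⟨K, hK, ρ, hρ0, hρ1, X1, h⟩ := gw_up hF hG
  obtain ⟨D, hD0, hD⟩ := hF.dv 4 (by norm_num)
  obtain ⟨X2, hX2⟩ := Filter.eventually_atTop.1 ((gw_xg hF).and ((gw_small hF (D * K) (1/2) (by norm_num)).and
    ((eventually_ge_atTop X1).and (eventually_ge_atTop 4))))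
  set A := 2 * K + 1 / F X2 with hA
  have hFX := hF.pos X2
  have hA0 : 0 < A := by positivity
  refine ⟨A, hA0, ?_⟩
  intro n
  induction n using Nat.strong_induction_on with
  | _ n ih =>
  intro x
  rcases le_total x X2 with hx | hx
  · have h1 : F X2 ≤ F x := hF.anti hx
    have : 1 ≤ A * F x := by
      calc 1 = 1 / F X2 * F X2 := by field_simp
        _ ≤ A * F x := by
          apply mul_le_mul _ h1 hFX.le hA0.le
          linarith
    exact (hG.le_one n x).trans this
  · obtain ⟨h1, h2, h3, h4⟩ := hX2 x hx
    have hFx := hF.pos x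
    have h5 := h x h3 0 n (Nat.zero_le _) (A * (D * F x)) (by positivity) (fun i hi =>
      (ih i hi (x/4)).trans (by gcongr; exact hD x (by linarith)))
    rw [hG.zero (x - x^g) (by linarith)] at h5
    have h6 : A * F x * (D * K * x^(1-2*g)) ≤ A * F x * (1/2) := by gcongr
    have h7 : 2 * K * F x ≤ A * F x := by
      gcongr
      have : 0 < 1 / F X2 := by positivity
      linarith
    rw [pow_zero] at h5
    nlinarith


def gwH (F : ℝ → ℝ) (m : ℝ) (n : ℕ) (x : ℝ) : ℝ :=
  ∑ i ∈ Finset.range n, m ^ i * F (m ^ (i + 1) * x)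

theorem gwH_ins {F : ℝ → ℝ} {m g : ℝ} (hF : GWTail F m g) (n : ℕ) :
    ∀ ε > (0:ℝ), ∀ᶠ x : ℝ in atTop, gwH F m n (x - x^g) ≤ gwH F m n x + ε * F x ∧
      gwH F m n x - ε * F x ≤ gwH F m n (x + x^g) := by
  have hm := hF.one_lt
  have hm0 : 0 < m := by linarith
  induction n with
  | zero =>
    intro ε hε
    refine Eventually.of_forall fun x => ?_
    have := hF.pos x
    simp only [gwH, Finset.range_zero, Finset.sum_empty]
    constructor <;> nlinarith
  | succ n ih =>
    intro ε hε
    obtain ⟨X, hX⟩ := hF.ins ((m^(n+1))^(1-g)) (by positivity) (ε / 2 / m^n) (by positivity)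
    filter_upwards [ih (ε/2) (by positivity), eventually_ge_atTop X, eventually_gt_atTop 0] with x h1 h2 h3
    have hM : 1 ≤ m^(n+1) := one_le_pow₀ hm.le
    have hMx : x ≤ m^(n+1) * x := by nlinarith
    have h4 := hX (m^(n+1) * x) (by linarith)
    have e : (m^(n+1))^(1-g) * (m^(n+1) * x)^g = m^(n+1) * x^g := by
      rw [Real.mul_rpow (by positivity) h3.le, ← mul_assoc, ← Real.rpow_add (by positivity)]
      simp
    rw [e, ← mul_sub, ← mul_add] at h4
    have hmn : 0 < m^n := by positivity
    have h5 := mul_le_mul_of_nonneg_left h4.1 hmn.le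
    have h6 := mul_le_mul_of_nonneg_left h4.2 hmn.le
    have h7 : F (m^(n+1) * x) ≤ F x := hF.anti hMx
    have e1 : m^n * ((1 + ε / 2 / m^n) * F (m^(n+1) * x)) = m^n * F (m^(n+1) * x) + ε / 2 * F (m^(n+1) * x) := by
      field_simp
    have e2 : m^n * ((1 - ε / 2 / m^n) * F (m^(n+1) * x)) = m^n * F (m^(n+1) * x) - ε / 2 * F (m^(n+1) * x) := by
      field_simp
    rw [e1] at h5
    rw [e2] at h6
    have h8 := mul_le_mul_of_nonneg_left h7 (show 0 ≤ ε/2 by positivity)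
    simp only [gwH] at h1 ⊢
    simp only [Finset.sum_range_succ]
    constructor <;> linarith [h1.1, h1.2]

theorem gw_fixed {F : ℝ → ℝ} {m g : ℝ} (hF : GWTail F m g) {G : ℕ → ℝ → ℝ} {V C x0 : ℝ}
    (hG : GWStep F m G V C x0) (n : ℕ) : ∀ ε > (0:ℝ), ∀ᶠ x : ℝ in atTop,
    gwH F m n x - ε * F x ≤ G n x ∧ G n x ≤ gwH F m n x + ε * F x := by
  obtain ⟨A, hA0, hA⟩ := gw_crude hF hG
  obtain ⟨D, hD0, hD⟩ := hF.dv 2 (by norm_num)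
  have hm := hF.one_lt
  have hm0 : 0 < m := by linarith
  have hV0 := hG.V0
  induction n with
  | zero =>
    intro ε hε
    filter_upwards [eventually_ge_atTop 1] with x hx
    rw [hG.zero x hx]
    have := hF.pos x
    simp only [gwH, Finset.range_zero, Finset.sum_empty]
    constructor <;> nlinarith
  | succ n ih =>
    intro ε hε
    have hz : Tendsto (fun y : ℝ => y - y ^ g) atTop atTop := by
      have h2 : Tendsto (fun y : ℝ => y / 2) atTop atTop := tendsto_id.atTop_div_const (by norm_num)
      refine tendsto_atTop_mono' _ ?_ h2
      filter_upwards [gw_xg hF] with y hy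
      linarith
    have hz' : Tendsto (fun y : ℝ => y + y ^ g) atTop atTop := by
      refine tendsto_atTop_mono' _ ?_ tendsto_id
      filter_upwards [eventually_ge_atTop 0] with y hy
      have := Real.rpow_nonneg hy g
      simp only [id]
      linarith
    have hη : 0 < ε / 5 := by positivity
    obtain ⟨X1, hX1⟩ := hG.U2 n (ε/5) hη
    obtain ⟨X2, hX2⟩ := hG.L2 n (ε/5) hη
    obtain ⟨X3, hX3⟩ := hF.ins 1 (by norm_num) 1 (by norm_num)
    filter_upwards [gw_xg hF, gw_small hF (A * D * (2 * V)) (ε/5) hη, gw_small hF (A * (2 * V)) (ε/5) hη,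
      hz.eventually (ih (ε/5) hη), hz'.eventually (ih (ε/5) hη), gwH_ins hF n (ε/5) hη,
      eventually_ge_atTop X1, eventually_ge_atTop X2, eventually_ge_atTop X3,
      eventually_ge_atTop 1] with x hxg hs1 hs2 hm1 hp1 hH hx1 hx2 hx3 hx
    have hxg0 : 0 < x^g := Real.rpow_pos_of_pos (by linarith) _
    have hFx := hF.pos x
    have hM : 1 ≤ m^(n+1) := one_le_pow₀ hm.le
    have hM' : 1 ≤ m^n := one_le_pow₀ hm.le
    have hMx : F (m^(n+1) * x) ≤ F x := hF.anti (by nlinarith)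
    have eb : ∀ b, 0 ≤ b → b ≤ 2 * x → b * V / (m^n * (x^g)^2) ≤ 2 * V * x^(1-2*g) := by
      intro b hb0 hb
      have e2 : x^(1-2*g) = x * ((x^g)^2)⁻¹ := by
        rw [← Real.rpow_natCast (x^g) 2, ← Real.rpow_mul (by linarith), ← Real.rpow_neg (by linarith)]
        nth_rewrite 2 [← Real.rpow_one x]
        rw [← Real.rpow_add (by linarith)]
        congr 1; push_cast; ring
      calc b * V / (m^n * (x^g)^2) ≤ (2 * x) * V / (1 * (x^g)^2) := by gcongr
        _ = _ := by rw [e2]; field_simp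
    have hx1g : 0 < x^(1-2*g) := Real.rpow_pos_of_pos (by linarith) _
    constructor
    · have h1 := hX2 x hx2 (x + x^g) (by linarith)
      rw [add_sub_cancel_left] at h1
      have h2 : G n (x + x^g) * ((x + x^g) * V / (m^n * (x^g)^2)) ≤ ε / 5 * F x := by
        calc _ ≤ (A * F x) * (2 * V * x^(1-2*g)) := by
              apply mul_le_mul _ (eb _ (by linarith) (by linarith)) _ (by positivity)
              · exact (hA _ _).trans (by gcongr; exact hF.anti (by linarith))
              · have : 0 ≤ x + x^g := by linarith
                positivity
          _ = (A * (2 * V) * x^(1-2*g)) * F x := by ring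
          _ ≤ _ := by gcongr
      have h3 : F (x + x^g) ≤ F x := hF.anti (by linarith)
      have h4 := mul_le_mul_of_nonneg_left h3 hη.le
      have h5 := mul_le_mul_of_nonneg_left hMx hη.le
      simp only [gwH] at hp1 hH ⊢
      simp only [Finset.sum_range_succ]
      linarith [hp1.1, hH.2]
    · have h1 := hX1 x hx1 (x - x^g) (by linarith)
      rw [sub_sub_cancel] at h1
      have h2 : G n (x/2) * (x * V / (m^n * (x^g)^2)) ≤ ε / 5 * F x := by
        calc _ ≤ (A * (D * F x)) * (2 * V * x^(1-2*g)) := by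
              apply mul_le_mul _ (eb _ (by linarith) (by linarith)) _ (by positivity)
              · exact (hA _ _).trans (by gcongr; exact hD x (by linarith))
              · have : 0 ≤ x := by linarith
                positivity
          _ = (A * D * (2 * V) * x^(1-2*g)) * F x := by ring
          _ ≤ _ := by gcongr
      have h3 := (hX3 x hx3).1
      rw [one_mul] at h3
      have h4 := mul_le_mul_of_nonneg_left h3 hη.le
      have h5 := mul_le_mul_of_nonneg_left hMx hη.le
      simp only [gwH] at hm1 hH ⊢
      simp only [Finset.sum_range_succ]
      linarith [hm1.2, hH.1]

theorem gwH_tail {F : ℝ → ℝ} {m g : ℝ} (hF : GWTail F m g) :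
    ∃ ρ > (0:ℝ), ρ < 1 ∧ ∃ c > (0:ℝ), ∀ x > (1:ℝ),
      Summable (fun i : ℕ => m ^ i * F (m ^ (i + 1) * x)) ∧
      ∀ I : ℕ, gwH F m I x ≤ ∑' i : ℕ, m ^ i * F (m ^ (i + 1) * x) ∧
        ∑' i : ℕ, m ^ i * F (m ^ (i + 1) * x) ≤ gwH F m I x + c * ρ^I * F x := by
  obtain ⟨ρ, hρ0, hρ1, c, hc0, hc⟩ := hF.tail
  have hm := hF.one_lt
  have hm0 : 0 < m := by linarith
  have hρ1' : 0 < 1 - ρ := by linarith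
  refine ⟨ρ, hρ0, hρ1, c / (1 - ρ), by positivity, fun x hx => ?_⟩
  have hn : ∀ i : ℕ, 0 ≤ m ^ i * F (m ^ (i + 1) * x) := fun i => by
    have := hF.pos (m ^ (i + 1) * x)
    positivity
  have hg := (hasSum_geometric_of_lt_one hρ0.le hρ1)
  have hs : Summable (fun i : ℕ => m ^ i * F (m ^ (i + 1) * x)) := by
    refine Summable.of_nonneg_of_le hn (fun i => hc x hx i) ?_
    exact (hg.summable.mul_left c).mul_right (F x)
  refine ⟨hs, fun I => ⟨hs.sum_le_tsum _ (fun i _ => hn i), ?_⟩⟩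
  rw [← hs.sum_add_tsum_nat_add I]
  unfold gwH
  gcongr
  have h2 : HasSum (fun i : ℕ => (c * ρ^I * F x) * ρ^i) ((c * ρ^I * F x) * (1-ρ)⁻¹) := hg.mul_left _
  have h3 : ∑' i : ℕ, m ^ (i+I) * F (m ^ (i + I + 1) * x) ≤ (c * ρ^I * F x) * (1-ρ)⁻¹ := by
    rw [← h2.tsum_eq]
    refine Summable.tsum_le_tsum (fun i => ?_) ((summable_nat_add_iff I).2 hs) h2.summable
    refine (hc x hx (i+I)).trans (le_of_eq ?_)
    ring
  refine h3.trans (le_of_eq ?_)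
  ring

theorem gw_uniform {F : ℝ → ℝ} {m g : ℝ} (hF : GWTail F m g) {G : ℕ → ℝ → ℝ} {V C x0 : ℝ}
    (hG : GWStep F m G V C x0) : ∀ ε > (0:ℝ), ∀ᶠ x : ℝ in atTop, ∀ n : ℕ,
    gwH F m n x - ε * F x ≤ G n x ∧ G n x ≤ gwH F m n x + ε * F x := by
  intro ε hε
  obtain ⟨A, hA0, hA⟩ := gw_crude hF hG
  obtain ⟨D, hD0, hD⟩ := hF.dv 4 (by norm_num)
  obtain ⟨K, hK, ρ, hρ0, hρ1, X1, hup⟩ := gw_up hF hG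
  obtain ⟨K', hK', X2, hlow⟩ := gw_low hF hG
  obtain ⟨ρ', hρ0', hρ1', c, hc0, hc⟩ := gwH_tail hF
  have hm := hF.one_lt
  have hm0 : 0 < m := by linarith
  have hη : 0 < ε / 5 := by positivity
  have hz : Tendsto (fun y : ℝ => y - y ^ g) atTop atTop := by
    have h2 : Tendsto (fun y : ℝ => y / 2) atTop atTop := tendsto_id.atTop_div_const (by norm_num)
    refine tendsto_atTop_mono' _ ?_ h2
    filter_upwards [gw_xg hF] with y hy
    linarith
  have hz' : Tendsto (fun y : ℝ => y + y ^ g) atTop atTop := by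
    refine tendsto_atTop_mono' _ ?_ tendsto_id
    filter_upwards [eventually_ge_atTop 0] with y hy
    have := Real.rpow_nonneg hy g
    simp only [id]
    linarith
  obtain ⟨I, hI1, hI2⟩ : ∃ I : ℕ, K * ρ^I ≤ ε/5 ∧ c * ρ'^I ≤ ε/5 := by
    have t1 : Tendsto (fun I : ℕ => K * ρ^I) atTop (nhds (K * 0)) :=
      (tendsto_pow_atTop_nhds_zero_of_lt_one hρ0.le hρ1).const_mul K
    have t2 : Tendsto (fun I : ℕ => c * ρ'^I) atTop (nhds (c * 0)) :=
      (tendsto_pow_atTop_nhds_zero_of_lt_one hρ0'.le hρ1').const_mul c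
    rw [mul_zero] at t1 t2
    obtain ⟨I, h1, h2⟩ := ((t1.eventually (gt_mem_nhds hη)).and (t2.eventually (gt_mem_nhds hη))).exists
    exact ⟨I, h1.le, h2.le⟩
  obtain ⟨X3, hX3⟩ := hF.ins 1 (by norm_num) 1 (by norm_num)
  have hfin : ∀ᶠ x : ℝ in atTop, ∀ n ∈ Finset.range I,
      gwH F m n x - ε * F x ≤ G n x ∧ G n x ≤ gwH F m n x + ε * F x := by
    rw [Filter.eventually_all_finset]
    intro n _
    exact gw_fixed hF hG n ε hε
  filter_upwards [hfin, gw_small hF (A * D * K) (ε/5) hη, gw_small hF (A * K') (ε/5) hη,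
      hz.eventually (gw_fixed hF hG I (ε/5) hη), hz'.eventually (gw_fixed hF hG I (ε/5) hη),
      gwH_ins hF I (ε/5) hη, eventually_ge_atTop X1, eventually_ge_atTop X2, eventually_ge_atTop X3,
      eventually_ge_atTop 2] with x hxf hs1 hs2 hm1 hp1 hH hx1 hx2 hx3 hx n
  rcases lt_or_ge n I with hn | hn
  · exact hxf n (Finset.mem_range.2 hn)
  have hFx := hF.pos x
  have hxg0 : 0 < x^g := Real.rpow_pos_of_pos (by linarith) _
  have hIn : gwH F m I x ≤ gwH F m n x := by
    unfold gwH
    refine Finset.sum_le_sum_of_subset_of_nonneg (Finset.range_mono hn) (fun i _ _ => ?_)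
    have := hF.pos (m ^ (i + 1) * x)
    positivity
  have hnI : gwH F m n x ≤ gwH F m I x + c * ρ'^I * F x :=
    (((hc x (by linarith)).2 n).1).trans ((hc x (by linarith)).2 I).2
  have b1 : c * ρ'^I * F x ≤ ε/5 * F x := by gcongr
  have b2 : K * ρ^I * F x ≤ ε/5 * F x := by gcongr
  constructor
  · have h1 := hlow x hx2 I n hn (A * F x) (by positivity) (fun i _ => hA i x)
    have h2 : A * F x * (K' * x^(1-2*g)) ≤ ε/5 * F x := by
      calc _ = A * K' * x^(1-2*g) * F x := by ring
        _ ≤ _ := by gcongr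
    have h3 : F (x + x^g) ≤ F x := hF.anti (by linarith)
    have h4 := mul_le_mul_of_nonneg_left h3 hη.le
    nlinarith [hp1.1, hH.2]
  · have h1 := hup x hx1 I n hn (A * (D * F x)) (by positivity) (fun i _ => (hA i _).trans (by
      gcongr; exact hD x (by linarith)))
    have h2 : A * (D * F x) * (K * x^(1-2*g)) ≤ ε/5 * F x := by
      calc _ = A * D * K * x^(1-2*g) * F x := by ring
        _ ≤ _ := by gcongr
    have h3 := (hX3 x hx3).1
    rw [one_mul] at h3
    have h4 := mul_le_mul_of_nonneg_left h3 hη.le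
    nlinarith [hm1.2, hH.1]

theorem gw_concl {F : ℝ → ℝ} {m g : ℝ} (hF : GWTail F m g) {G : ℕ → ℝ → ℝ} {V C x0 : ℝ}
    (hG : GWStep F m G V C x0) (Ginf : ℝ → ℝ)
    (hi1 : ∀ x B : ℝ, (∀ᶠ n in atTop, G n x ≤ B) → Ginf x ≤ B)
    (hi2 : ∀ x x' B : ℝ, x < x' → (∀ᶠ n in atTop, B ≤ G n x') → B ≤ Ginf x) :
    (∀ ε > (0 : ℝ), ∃ x₀ : ℝ, ∀ x ≥ x₀, ∀ n : ℕ, 1 ≤ n →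
        |G n x / (∑ i ∈ Finset.range n, m ^ i * F (m ^ (i + 1) * x)) - 1| < ε) ∧
    (∀ ε > (0 : ℝ), ∃ x₀ : ℝ, ∃ N : ℕ, ∀ x ≥ x₀, ∀ n ≥ N,
        |G n x / (∑' i : ℕ, m ^ i * F (m ^ (i + 1) * x)) - 1| < ε) ∧
    Tendsto (fun x : ℝ => Ginf x /
        (∑' i : ℕ, m ^ i * F (m ^ (i + 1) * x))) atTop (nhds 1) := by
  have hm := hF.one_lt
  have hm0 : 0 < m := by linarith
  obtain ⟨D, hD0, hD⟩ := hF.dv m hm.le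
  obtain ⟨ρ', hρ0', hρ1', c, hc0, hc⟩ := gwH_tail hF
  have hlow : ∀ n : ℕ, 1 ≤ n → ∀ x ≥ (0:ℝ), F x / D ≤ gwH F m n x := by
    intro n hn x hx
    have h1 : F x ≤ D * F (m * x) := by
      have := hD (m * x) (by positivity)
      rwa [mul_div_cancel_left₀ _ hm0.ne'] at this
    have h2 : m^0 * F (m^(0+1) * x) ≤ gwH F m n x := by
      unfold gwH
      refine Finset.single_le_sum (f := fun i => m ^ i * F (m ^ (i + 1) * x)) (fun i _ => ?_) (Finset.mem_range.2 hn)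
      have := hF.pos (m ^ (i + 1) * x)
      positivity
    rw [div_le_iff₀ hD0]
    simp only [pow_zero, zero_add, pow_one, one_mul] at h2
    nlinarith
  have ratio : ∀ ε > (0:ℝ), ∀ x a h : ℝ, F x / D ≤ h → h - ε / (2 * D) * F x ≤ a → a ≤ h + ε / (2 * D) * F x →
      |a / h - 1| < ε := by
    intro ε hε x a h h1 h2 h3
    have hFx := hF.pos x
    have hh : 0 < h := lt_of_lt_of_le (by positivity) h1
    rw [div_sub_one hh.ne', abs_div, abs_of_pos hh, div_lt_iff₀ hh]
    have : |a - h| ≤ ε / (2 * D) * F x := abs_le.2 ⟨by linarith, by linarith⟩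
    refine this.trans_lt ?_
    calc ε / (2 * D) * F x = ε / 2 * (F x / D) := by ring
      _ ≤ ε / 2 * h := by gcongr
      _ < ε * h := by gcongr; linarith
  have unif2 : ∀ ε > (0:ℝ), ∃ N : ℕ, ∀ᶠ x : ℝ in atTop, ∀ n ≥ N,
      ∑' i : ℕ, m ^ i * F (m ^ (i + 1) * x) - ε * F x ≤ G n x ∧
      G n x ≤ ∑' i : ℕ, m ^ i * F (m ^ (i + 1) * x) + ε * F x := by
    intro ε hε
    have t2 : Tendsto (fun I : ℕ => c * ρ'^I) atTop (nhds (c * 0)) :=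
      (tendsto_pow_atTop_nhds_zero_of_lt_one hρ0'.le hρ1').const_mul c
    rw [mul_zero] at t2
    obtain ⟨N, hN⟩ := Filter.eventually_atTop.1 (t2.eventually (gt_mem_nhds (half_pos hε)))
    refine ⟨N, ?_⟩
    filter_upwards [gw_uniform hF hG (ε/2) (by positivity), eventually_gt_atTop 1] with x h1 hx n hn
    have hFx := hF.pos x
    have h2 := (hc x hx).2 n
    have h3 := h1 n
    have h4 : c * ρ'^n * F x ≤ ε/2 * F x := mul_le_mul_of_nonneg_right (hN n hn).le hFx.le
    constructor <;> nlinarith [h2.1, h2.2, h3.1, h3.2]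
  have hlowT : ∀ x > (1:ℝ), F x / D ≤ ∑' i : ℕ, m ^ i * F (m ^ (i + 1) * x) := fun x hx =>
    (hlow 1 le_rfl x (by linarith)).trans ((hc x hx).2 1).1
  refine ⟨?_, ?_, ?_⟩
  · intro ε hε
    rw [← Filter.eventually_atTop]
    filter_upwards [gw_uniform hF hG (ε / (2 * D)) (by positivity), eventually_ge_atTop 0] with x h1 hx n hn
    exact ratio ε hε x _ _ (hlow n hn x hx) (h1 n).1 (h1 n).2
  · intro ε hε
    obtain ⟨N, hN⟩ := unif2 (ε / (2 * D)) (by positivity)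
    obtain ⟨x0, hx0⟩ := Filter.eventually_atTop.1 (hN.and (eventually_gt_atTop 1))
    refine ⟨x0, N, fun x hx n hn => ?_⟩
    exact ratio ε hε x _ _ (hlowT x (hx0 x hx).2) ((hx0 x hx).1 n hn).1 ((hx0 x hx).1 n hn).2
  · rw [Metric.tendsto_atTop]
    intro ε hε
    set η := ε / (2 * D) / 4 with hη
    have hη0 : 0 < η := by positivity
    obtain ⟨N, hN⟩ := unif2 η hη0
    have t2 : Tendsto (fun I : ℕ => c * ρ'^I) atTop (nhds (c * 0)) :=
      (tendsto_pow_atTop_nhds_zero_of_lt_one hρ0'.le hρ1').const_mul c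
    rw [mul_zero] at t2
    obtain ⟨I, hI⟩ := (t2.eventually (gt_mem_nhds hη0)).exists
    have hz' : Tendsto (fun y : ℝ => y + y ^ g) atTop atTop := by
      refine tendsto_atTop_mono' _ ?_ tendsto_id
      filter_upwards [eventually_ge_atTop 0] with y hy
      have := Real.rpow_nonneg hy g
      simp only [id]
      linarith
    rw [← Filter.eventually_atTop]
    filter_upwards [hN, hz'.eventually hN, gwH_ins hF I η hη0, eventually_gt_atTop 1] with x h1 h2 h3 hx
    rw [Real.dist_eq]
    have hFx := hF.pos x
    have hxg0 : 0 < x^g := Real.rpow_pos_of_pos (by linarith) _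
    have h4 : F (x + x^g) ≤ F x := hF.anti (by linarith)
    have h5 := mul_le_mul_of_nonneg_left h4 hη0.le
    have h6 := ((hc x hx).2 I).2
    have h7 := ((hc (x + x^g) (by linarith)).2 I).1
    have h8 : c * ρ'^I * F x ≤ η * F x := by gcongr
    have h9 : ε / (2 * D) * F x = 4 * (η * F x) := by rw [hη]; ring
    have hηF : 0 < η * F x := by positivity
    refine ratio ε hε x _ _ (hlowT x hx) ?_ ?_
    · refine hi2 x (x + x^g) _ (by linarith) ?_
      filter_upwards [eventually_ge_atTop N] with n hn
      have := (h2 n hn).1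
      linarith [h3.2]
    · refine hi1 x _ ?_
      filter_upwards [eventually_ge_atTop N] with n hn
      have := (h1 n hn).2
      linarith


structure GWIid {Ω : Type*} [MeasurableSpace Ω] (μ : Measure Ω) (ν : Measure ℕ) (X : ℕ → Ω → ℕ) : Prop where
  meas : ∀ i, Measurable (X i)
  indep : iIndepFun X μ
  law : ∀ i, μ.map (X i) = ν

structure GWLaw (ν : Measure ℕ) (F : ℝ → ℝ) (m : ℝ) : Prop where
  prob : IsProbabilityMeasure ν
  tail : ∀ t, F t = ν.real {k : ℕ | t < (k:ℝ)}
  int1 : Integrable (fun k : ℕ => (k:ℝ)) ν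
  mean : m = ∫ k, (k:ℝ) ∂ν
  int2 : Integrable (fun k : ℕ => (k:ℝ)^2) ν

section
variable {Ω : Type*} [MeasurableSpace Ω] {μ : Measure Ω} [IsProbabilityMeasure μ] {ν : Measure ℕ}
  {F : ℝ → ℝ} {m g : ℝ}

theorem gw_cheb (hL : GWLaw ν F m) : ∃ V ≥ (0:ℝ), ∀ X : ℕ → Ω → ℕ, GWIid μ ν X → ∀ k : ℕ, ∀ a > (0:ℝ),
    μ.real {ω | a ≤ |((∑ i ∈ Finset.range k, X i ω : ℕ) : ℝ) - k * m|} ≤ k * V / a^2 := by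
  have := hL.prob
  refine ⟨variance (fun k : ℕ => (k:ℝ)) ν, variance_nonneg _ _, fun X hX k a ha => ?_⟩
  have hcm : Measurable (fun k : ℕ => (k:ℝ)) := measurable_from_top
  have hL2 : MemLp (fun k : ℕ => (k:ℝ)) 2 ν := (memLp_two_iff_integrable_sq hcm.aestronglyMeasurable).2 hL.int2
  have h2 : ∀ i, MemLp (fun ω => (X i ω : ℝ)) 2 μ := fun i => by
    have := (hX.law i).symm ▸ hL2
    exact this.comp_of_map (hX.meas i).aemeasurable
  have hvar : ∀ i, variance (fun ω => (X i ω : ℝ)) μ = variance (fun k : ℕ => (k:ℝ)) ν := fun i => by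
    have := variance_map (μ := μ) (X := fun k : ℕ => (k:ℝ)) (Y := X i) hcm.aemeasurable (hX.meas i).aemeasurable
    rw [hX.law i] at this
    exact this.symm
  have hmean : ∀ i, ∫ ω, (X i ω : ℝ) ∂μ = m := fun i => by
    rw [hL.mean, ← hX.law i, integral_map (hX.meas i).aemeasurable hcm.aestronglyMeasurable]
  have hS : MemLp (∑ i ∈ Finset.range k, (fun ω => (X i ω : ℝ))) 2 μ := memLp_finsetSum' _ (fun i _ => h2 i)
  have hv : variance (∑ i ∈ Finset.range k, (fun ω => (X i ω : ℝ))) μ = k * variance (fun k : ℕ => (k:ℝ)) ν := by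
    rw [IndepFun.variance_sum (fun i _ => h2 i)]
    · simp [hvar]
    · intro i _ j _ hij
      exact (hX.indep.indepFun hij).comp hcm hcm
  have hE : μ[∑ i ∈ Finset.range k, (fun ω => (X i ω : ℝ))] = k * m := by
    simp only [Finset.sum_apply]
    rw [integral_finsetSum _ (fun i _ => (h2 i).integrable (by norm_num))]
    simp [hmean]
  have h := meas_ge_le_variance_div_sq hS ha
  rw [hE, hv] at h
  have h3 := ENNReal.toReal_mono ENNReal.ofReal_ne_top h
  rw [ENNReal.toReal_ofReal (by have := variance_nonneg (fun k : ℕ => (k:ℝ)) ν; positivity)] at h3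
  simpa [Measure.real, Finset.sum_apply] using h3

theorem gw_tailX (hL : GWLaw ν F m) {X : ℕ → Ω → ℕ} (hX : GWIid μ ν X) (i : ℕ) (t : ℝ) :
    μ.real {ω | t < (X i ω : ℝ)} = F t := by
  rw [hL.tail, ← hX.law i, map_measureReal_apply (hX.meas i) (MeasurableSet.of_discrete)]
  rfl

theorem gw_exp_le (u : ℝ) (hu : 0 ≤ u) : Real.exp u ≤ 1 + u + u^2 * Real.exp u := by
  have h := Real.add_one_le_exp (-u)
  have h2 : Real.exp (-u) * Real.exp u = 1 := by rw [← Real.exp_add]; simp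
  have h3 := Real.exp_pos u
  have h4 : 1 ≤ (1 + u) * Real.exp (-u) + u^2 := by nlinarith
  nlinarith [mul_le_mul_of_nonneg_right h4 h3.le]

theorem gw_mgf (hL : GWLaw ν F m) {X : ℕ → Ω → ℕ} (hX : GWIid μ ν X) (k : ℕ) (b l t : ℝ) (hl : 0 ≤ l) :
    μ.real {ω | t < ((∑ i ∈ Finset.range k, X i ω : ℕ) : ℝ)} ≤ k * F b +
      Real.exp (- l * t + k * (l * m + l^2 * Real.exp (l * b) * ∫ j, (j:ℝ)^2 ∂ν)) := by
  have := hL.prob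
  set M2 := ∫ j, (j:ℝ)^2 ∂ν with hM2
  set τ : ℕ → ℝ := fun j => if (j:ℝ) ≤ b then (j:ℝ) else 0 with hτ
  have hτm : Measurable τ := measurable_from_top
  have hτ0 : ∀ j, 0 ≤ τ j := fun j => by simp only [hτ]; split_ifs <;> positivity
  have hτ1 : ∀ j, τ j ≤ j := fun j => by
    simp only [hτ]; split_ifs
    · exact le_rfl
    · positivity
  have hexp : ∀ j, Real.exp (l * τ j) ≤ 1 + l * j + l^2 * Real.exp (l * b) * (j:ℝ)^2 := by
    intro j
    by_cases hj : (j:ℝ) ≤ b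
    · simp only [hτ, hj, if_true]
      have h1 := gw_exp_le (l * j) (by positivity)
      have h2 : Real.exp (l * j) ≤ Real.exp (l * b) := Real.exp_le_exp.2 (by gcongr)
      have h3 : (l * j)^2 * Real.exp (l * j) ≤ (l * j)^2 * Real.exp (l * b) := by gcongr
      nlinarith
    · simp only [hτ, hj, if_false, mul_zero, Real.exp_zero]
      have : 0 ≤ l * j := by positivity
      have : 0 ≤ l^2 * Real.exp (l * b) * (j:ℝ)^2 := by positivity
      linarith
  have hbint : Integrable (fun j : ℕ => 1 + l * (j:ℝ) + l^2 * Real.exp (l * b) * (j:ℝ)^2) ν :=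
    ((integrable_const _).add (hL.int1.const_mul l)).add (hL.int2.const_mul _)
  have heint : Integrable (fun j : ℕ => Real.exp (l * τ j)) ν := by
    refine hbint.mono' (measurable_from_top.aestronglyMeasurable) (Eventually.of_forall fun j => ?_)
    rw [Real.norm_eq_abs, Real.abs_exp]
    exact hexp j
  have hmgf1 : ∫ j, Real.exp (l * τ j) ∂ν ≤ Real.exp (l * m + l^2 * Real.exp (l * b) * M2) := by
    calc _ ≤ ∫ j : ℕ, (1 + l * (j:ℝ) + l^2 * Real.exp (l * b) * (j:ℝ)^2) ∂ν :=
          integral_mono heint hbint hexp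
      _ = 1 + l * m + l^2 * Real.exp (l * b) * M2 := by
        have hi1 : Integrable (fun j : ℕ => 1 + l * (j:ℝ)) ν := (integrable_const _).add (hL.int1.const_mul l)
        rw [integral_add hi1 (hL.int2.const_mul _),
          integral_add (integrable_const _) (hL.int1.const_mul l), integral_const_mul, integral_const_mul,
          ← hL.mean, ← hM2]
        simp
      _ ≤ _ := by
        have := Real.add_one_le_exp (l * m + l^2 * Real.exp (l * b) * M2)
        linarith
  have hYm : ∀ i, Measurable (fun ω => τ (X i ω)) := fun i => hτm.comp (hX.meas i)
  have hYind : iIndepFun (fun i ω => τ (X i ω)) μ := hX.indep.comp (fun _ => τ) (fun _ => hτm)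
  have hmY : ∀ i, mgf (fun ω => τ (X i ω)) μ l = ∫ j, Real.exp (l * τ j) ∂ν := fun i => by
    unfold mgf
    rw [← hX.law i, integral_map (hX.meas i).aemeasurable measurable_from_top.aestronglyMeasurable]
  have hmS : mgf (∑ i ∈ Finset.range k, (fun ω => τ (X i ω))) μ l ≤
      Real.exp (k * (l * m + l^2 * Real.exp (l * b) * M2)) := by
    rw [hYind.mgf_sum hYm]
    simp only [hmY, Finset.prod_const, Finset.card_range]
    rw [Real.exp_nat_mul]
    gcongr
  have hSint : Integrable (fun ω => Real.exp (l * (∑ i ∈ Finset.range k, (fun ω => τ (X i ω))) ω)) μ := by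
    refine hYind.integrable_exp_mul_sum hYm (fun i _ => ?_)
    have := (hX.law i).symm ▸ heint
    exact this.comp_measurable (hX.meas i)
  have hch := measure_ge_le_exp_mul_mgf t hl hSint
  have hsub : {ω | t < ((∑ i ∈ Finset.range k, X i ω : ℕ) : ℝ)} ⊆
      (⋃ i ∈ Finset.range k, {ω | b < (X i ω : ℝ)}) ∪
        {ω | t ≤ (∑ i ∈ Finset.range k, (fun ω => τ (X i ω))) ω} := by
    intro ω hω
    by_cases hall : ∃ i ∈ Finset.range k, b < (X i ω : ℝ)
    · left
      simpa using hall
    · right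
      push Not at hall
      simp only [Set.mem_ofPred_eq, Finset.sum_apply] at hω ⊢
      rw [Finset.sum_congr rfl (fun i hi => show τ (X i ω) = (X i ω : ℝ) by
        simp only [hτ, hall i hi, if_true])]
      push_cast at hω
      exact hω.le
  calc _ ≤ _ := measureReal_mono hsub
    _ ≤ _ := measureReal_union_le _ _
    _ ≤ k * F b + Real.exp (- l * t) * Real.exp (k * (l * m + l^2 * Real.exp (l * b) * M2)) := by
      gcongr
      · refine (measureReal_biUnion_finset_le _ _).trans (le_of_eq ?_)
        simp [gw_tailX hL hX]
      · exact hch.trans (by gcongr)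
    _ = _ := by rw [← Real.exp_add]

theorem gw_nagaev (hF : GWTail F m g) (hL : GWLaw ν F m) : ∃ C ≥ (0:ℝ), ∀ X : ℕ → Ω → ℕ, GWIid μ ν X →
    ∀ k : ℕ, ∀ t ≥ (1:ℝ), k * m ≤ 2/3 * t →
    μ.real {ω | t < ((∑ i ∈ Finset.range k, X i ω : ℕ) : ℝ)} ≤ C * k * F t := by
  obtain ⟨p, hp, c, hc, hpl⟩ := hF.pow_lower
  have hm := hF.one_lt
  set M := 6 * p + 1 with hM
  have hM1 : 1 ≤ M := by linarith
  obtain ⟨D, hD0, hD⟩ := hF.dv M hM1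
  set M2 := ∫ j, (j:ℝ)^2 ∂ν with hM2
  have hM20 : 0 ≤ M2 := integral_nonneg (fun j => by positivity)
  set E0 := 16/6 * M^2 * M2 with hE0
  refine ⟨D + Real.exp E0 / c, by positivity, fun X hX k t ht hk => ?_⟩
  rcases Nat.eq_zero_or_pos k with rfl | hk0
  · have : {ω : Ω | t < ((∑ i ∈ Finset.range 0, X i ω : ℕ) : ℝ)} = ∅ := by
      ext ω; simp; linarith
    rw [this]; simp
  have hk1 : (1:ℝ) ≤ k := by exact_mod_cast hk0
  have ht0 : 0 < t := by linarith
  set L := Real.log t with hLd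
  have hL0 : 0 ≤ L := Real.log_nonneg ht
  have h := gw_mgf hL hX k (t / M) (L * M / (2 * t)) t (by positivity)
  refine h.trans ?_
  have hFt := hF.pos t
  have e1 : L * M / (2 * t) * (t / M) = L / 2 := by field_simp
  have e2 : Real.exp (L / 2) = t ^ ((1:ℝ)/2) := by
    rw [Real.rpow_def_of_pos ht0]; congr 1; rw [hLd]; ring
  have hlog : L ≤ 4 * t ^ ((1:ℝ)/4) := by
    have := Real.log_le_rpow_div ht0.le (ε := 1/4) (by norm_num)
    rw [hLd]; linarith
  have hq : (t ^ ((1:ℝ)/4))^2 = t ^ ((1:ℝ)/2) := by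
    rw [← Real.rpow_natCast, ← Real.rpow_mul ht0.le]; norm_num
  have hh : (t ^ ((1:ℝ)/2))^2 = t := by
    rw [← Real.rpow_natCast, ← Real.rpow_mul ht0.le]; norm_num
  have hlog2 : L^2 ≤ 16 * t ^ ((1:ℝ)/2) := by
    rw [← hq]
    nlinarith [Real.rpow_nonneg ht0.le ((1:ℝ)/4)]
  have hkt : (k:ℝ) ≤ 2/3 * t := by nlinarith
  have hexpo : - (L * M / (2 * t)) * t + k * (L * M / (2 * t) * m + (L * M / (2 * t))^2 *
      Real.exp (L * M / (2 * t) * (t / M)) * M2) ≤ - p * L + E0 := by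
    rw [e1, e2]
    have a1 : - (L * M / (2 * t)) * t = - (L * M / 2) := by field_simp
    have a2 : k * (L * M / (2 * t) * m) ≤ L * M / 3 := by
      calc k * (L * M / (2 * t) * m) = (L * M / (2 * t)) * (k * m) := by ring
        _ ≤ (L * M / (2 * t)) * (2/3 * t) := by gcongr
        _ = _ := by field_simp
    have a3 : k * ((L * M / (2 * t))^2 * t ^ ((1:ℝ)/2) * M2) ≤ E0 := by
      calc k * ((L * M / (2 * t))^2 * t ^ ((1:ℝ)/2) * M2)
          ≤ (2/3 * t) * ((L * M / (2 * t))^2 * t ^ ((1:ℝ)/2) * M2) := by gcongr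
        _ = (L^2 * t ^ ((1:ℝ)/2)) * (M^2 * M2 / (6 * t)) := by field_simp; ring
        _ ≤ (16 * t ^ ((1:ℝ)/2) * t ^ ((1:ℝ)/2)) * (M^2 * M2 / (6 * t)) := by gcongr
        _ = 16 * (t ^ ((1:ℝ)/2))^2 * (M^2 * M2 / (6 * t)) := by ring
        _ = E0 := by rw [hh, hE0]; field_simp
    rw [a1, mul_add (k:ℝ)]
    have a4 : - p * L - (- (L * M / 2) + L * M / 3) = L / 6 := by rw [hM]; ring
    linarith
  have hfin : Real.exp (- p * L + E0) ≤ Real.exp E0 / c * F t := by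
    have : Real.exp (-p * L) = t ^ (-p) := by
      rw [Real.rpow_def_of_pos ht0, mul_comm]
    rw [Real.exp_add, this]
    have := hpl t ht
    calc t ^ (-p) * Real.exp E0 = Real.exp E0 / c * (c * t ^ (-p)) := by field_simp
      _ ≤ _ := by gcongr
  have hfin2 : Real.exp E0 / c * F t ≤ Real.exp E0 / c * k * F t := by
    gcongr
    have : 0 < Real.exp E0 / c := by positivity
    nlinarith
  calc _ ≤ k * (D * F t) + Real.exp (- p * L + E0) := by
        gcongr
        exact hD t ht0.le
    _ ≤ k * (D * F t) + Real.exp E0 / c * k * F t := by linarith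
    _ = _ := by ring
end


theorem gw_sub_aux {k D a f p q θ : ℝ} (hk : 0 ≤ k) (hD : 0 ≤ D) (hf : 0 ≤ f) (ha : 0 ≤ a)
    (h1 : a ≤ θ) (h2 : q ≤ D * f) (h3 : p ≤ k * q + 1 * q) : p * a ≤ (k + 1) * (D + 1) * θ * f := by
  have hp : p ≤ (k+1) * (D * f) := by
    have : (k+1) * q ≤ (k+1) * (D * f) := by gcongr
    linarith
  have hθ : 0 ≤ θ := ha.trans h1
  calc p * a ≤ ((k+1) * (D * f)) * a := by gcongr
    _ ≤ ((k+1) * (D * f)) * θ := by gcongr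
    _ ≤ (k + 1) * (D + 1) * θ * f := by
      have : 0 ≤ (k+1) * θ * f := by positivity
      linarith

theorem gw_sub_aux2 {k D a f p q θ : ℝ} (hk : 0 ≤ k) (hD : 0 ≤ D) (hf : 0 ≤ f) (hq : 0 ≤ q)
    (h1 : a ≤ θ) (h2 : q ≤ D * f) (h3 : p ≤ k * a + 1 * a) (hθ : 0 ≤ θ) :
    p * q ≤ (k + 1) * (D + 1) * θ * f := by
  have hp : p ≤ (k+1) * θ := by
    have : (k+1) * a ≤ (k+1) * θ := by gcongr
    linarith
  calc p * q ≤ ((k+1) * θ) * q := by gcongr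
    _ ≤ ((k+1) * θ) * (D * f) := by gcongr
    _ ≤ (k + 1) * (D + 1) * θ * f := by
      have : 0 ≤ (k+1) * θ * f := by positivity
      linarith

set_option maxHeartbeats 1000000 in
theorem gw_subexp {Ω : Type*} [MeasurableSpace Ω] {μ : Measure Ω} [IsProbabilityMeasure μ] {ν : Measure ℕ}
    {F : ℝ → ℝ} {m g : ℝ} (hF : GWTail F m g) (hL : GWLaw ν F m) {X : ℕ → Ω → ℕ} (hX : GWIid μ ν X) (k : ℕ) :
    ∀ ε > (0:ℝ), ∀ᶠ t : ℝ in atTop,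
      k * F t - ε * F t ≤ μ.real {ω | t < ((∑ i ∈ Finset.range k, X i ω : ℕ) : ℝ)} ∧
      μ.real {ω | t < ((∑ i ∈ Finset.range k, X i ω : ℕ) : ℝ)} ≤ k * F t + ε * F t := by
  induction k with
  | zero =>
    intro ε hε
    filter_upwards [eventually_ge_atTop 0] with t ht
    have : {ω : Ω | t < ((∑ i ∈ Finset.range 0, X i ω : ℕ) : ℝ)} = ∅ := by
      ext ω; simp; linarith
    rw [this]
    have := hF.pos t
    simp
    positivity
  | succ k ih =>
    intro ε hε
    set P : ℝ → ℝ := fun t => μ.real {ω | t < ((∑ i ∈ Finset.range k, X i ω : ℕ) : ℝ)} with hP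
    have hTm : Measurable (fun ω => ∑ i ∈ Finset.range k, X i ω) :=
      Finset.measurable_sum _ (fun i _ => hX.meas i)
    have hind : IndepFun (fun ω => ∑ i ∈ Finset.range k, X i ω) (X k) μ := by
      have := hX.indep.indepFun_sum_range_succ hX.meas k
      convert this using 1
      ext ω; simp
    have hprod : ∀ s t : ℝ, μ.real ({ω | s < ((∑ i ∈ Finset.range k, X i ω : ℕ) : ℝ)} ∩ {ω | t < (X k ω : ℝ)})
        = P s * F t := by
      intro s t
      have := hind.measure_inter_preimage_eq_mul {j : ℕ | s < (j:ℝ)} {j : ℕ | t < (j:ℝ)}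
        MeasurableSet.of_discrete MeasurableSet.of_discrete
      have h2 := congrArg ENNReal.toReal this
      rw [ENNReal.toReal_mul] at h2
      rw [← gw_tailX hL hX k t]
      exact h2
    have hA : ∀ s : ℝ, MeasurableSet {ω | s < (X k ω : ℝ)} := fun s =>
      (hX.meas k) (MeasurableSet.of_discrete (s := {j : ℕ | s < (j:ℝ)}))
    have hz : Tendsto (fun y : ℝ => y - y ^ g) atTop atTop := by
      have h2 : Tendsto (fun y : ℝ => y / 2) atTop atTop := tendsto_id.atTop_div_const (by norm_num)
      refine tendsto_atTop_mono' _ ?_ h2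
      filter_upwards [gw_xg hF] with y hy
      linarith
    have hz2 : Tendsto (fun y : ℝ => y / 2) atTop atTop := tendsto_id.atTop_div_const (by norm_num)
    have hzg : Tendsto (fun y : ℝ => y ^ g) atTop atTop := tendsto_rpow_atTop (by linarith [hF.g_half])
    obtain ⟨D, hD0, hD⟩ := hF.dv 2 (by norm_num)
    set η := ε / 8 with hη
    have hη0 : 0 < η := by positivity
    set κ := min 1 (η / (k + 1)) with hκ
    have hκ0 : 0 < κ := by positivity
    have hκ1 : κ ≤ 1 := min_le_left _ _
    have hκ2 : (k+1) * κ ≤ η := by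
      have : κ ≤ η / (k+1) := min_le_right _ _
      rwa [le_div_iff₀ (by positivity), mul_comm] at this
    obtain ⟨X3, hX3⟩ := hF.ins 1 (by norm_num) κ hκ0
    set θ := η / ((k + 1) * (D + 1)) with hθ
    have hθ0 : 0 < θ := by positivity
    have hθ1 : (k+1) * (D+1) * θ = η := by rw [hθ]; field_simp
    have hsm : ∀ᶠ t in atTop, F t < θ := hF.lim.eventually (gt_mem_nhds hθ0)
    have ih1 := ih 1 one_pos
    filter_upwards [ih η hη0, hz.eventually (ih η hη0), hz2.eventually ih1, hzg.eventually ih1,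
      hzg.eventually hsm, hsm, eventually_ge_atTop X3, eventually_ge_atTop 0]
      with t i1 i2 i3 i4 s1 s2 hx3 ht
    have hFt := hF.pos t
    have hFg := hF.pos (t^g)
    have hFm := hF.pos (t - t^g)
    have hF2 := hF.pos (t/2)
    have hk0 : (0:ℝ) ≤ k := Nat.cast_nonneg k
    constructor
    · have hsub : {ω | t < ((∑ i ∈ Finset.range k, X i ω : ℕ) : ℝ)} ∪ {ω | t < (X k ω : ℝ)} ⊆
          {ω | t < ((∑ i ∈ Finset.range (k+1), X i ω : ℕ) : ℝ)} := by
        intro ω hω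
        simp only [Set.mem_union, Set.mem_ofPred_eq, Finset.sum_range_succ] at hω ⊢
        push_cast at hω ⊢
        have h1 : (0:ℝ) ≤ X k ω := Nat.cast_nonneg _
        have h2 : (0:ℝ) ≤ ∑ i ∈ Finset.range k, (X i ω : ℝ) := Finset.sum_nonneg (fun i _ => Nat.cast_nonneg _)
        rcases hω with h | h <;> linarith
      have h1 := measureReal_mono (μ := μ) hsub
      have h2 := measureReal_union_add_inter (μ := μ) (s := {ω | t < ((∑ i ∈ Finset.range k, X i ω : ℕ) : ℝ)}) (hA t)
      rw [hprod, gw_tailX hL hX k t] at h2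
      have h3 : P t ≤ (k + η) * F t := by
        have := i1.2
        simp only [hP]; linarith
      have hP1 : P t ≤ 1 := measureReal_le_one
      have h4 : P t * F t ≤ 2 * η * F t := by
        have : (k:ℝ) * F t ≤ η := by
          have : (k:ℝ) * F t ≤ (k+1) * (D+1) * θ := by
            apply mul_le_mul _ s2.le hFt.le (by positivity)
            nlinarith
          linarith
        have hF1 : F t ≤ 1 := by
          rw [← gw_tailX hL hX k t]; exact measureReal_le_one
        gcongr
        nlinarith
      have i1' : k * F t - η * F t ≤ P t := i1.1
      have hfold : μ.real {ω | t < ((∑ i ∈ Finset.range k, X i ω : ℕ) : ℝ)} = P t := rfl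
      rw [hfold] at h2
      have hk1 : ((k+1:ℕ):ℝ) = k+1 := by push_cast; ring
      rw [hk1]
      have e1 : ε * F t = 8 * (η * F t) := by rw [hη]; ring
      have e2 : 0 < η * F t := by positivity
      linarith
    · have hsub : {ω | t < ((∑ i ∈ Finset.range (k+1), X i ω : ℕ) : ℝ)} ⊆
          ({ω | t - t^g < ((∑ i ∈ Finset.range k, X i ω : ℕ) : ℝ)} ∪ {ω | t - t^g < (X k ω : ℝ)}) ∪
          (({ω | t/2 < ((∑ i ∈ Finset.range k, X i ω : ℕ) : ℝ)} ∩ {ω | t^g < (X k ω : ℝ)}) ∪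
          ({ω | t^g < ((∑ i ∈ Finset.range k, X i ω : ℕ) : ℝ)} ∩ {ω | t/2 < (X k ω : ℝ)})) := by
        intro ω hω
        simp only [Set.mem_union, Set.mem_inter_iff, Set.mem_ofPred_eq, Finset.sum_range_succ] at hω ⊢
        push_cast at hω ⊢
        by_contra hcon
        push Not at hcon
        obtain ⟨⟨h1, h2⟩, h3, h4⟩ := hcon
        rcases lt_or_ge (t/2) (∑ i ∈ Finset.range k, (X i ω : ℝ)) with h | h
        · have := h3 h
          linarith
        · have := h4 (by linarith)
          linarith
      have h1 := (measureReal_mono (μ := μ) hsub).trans ((measureReal_union_le _ _).trans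
        (add_le_add (measureReal_union_le _ _) (measureReal_union_le _ _)))
      rw [hprod, hprod, gw_tailX hL hX k (t - t^g)] at h1
      have h2 : F (t - t^g) ≤ (1 + κ) * F t := by
        have := (hX3 t hx3).1
        rwa [one_mul] at this
      have h3 : F (t/2) ≤ D * F t := hD t ht
      have i2' : P (t - t^g) ≤ k * F (t - t^g) + η * F (t - t^g) := i2.2
      have i3' : P (t/2) ≤ k * F (t/2) + 1 * F (t/2) := i3.2
      have i4' : P (t^g) ≤ k * F (t^g) + 1 * F (t^g) := i4.2
      have j1 : P (t/2) * F (t^g) ≤ η * F t := by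
        rw [← hθ1]
        exact gw_sub_aux hk0 hD0.le hFt.le hFg.le s1.le h3 i3'
      have j2 : P (t^g) * F (t/2) ≤ η * F t := by
        rw [← hθ1]
        exact gw_sub_aux2 hk0 hD0.le hFt.le hF2.le s1.le h3 i4' hθ0.le
      have j3 : (k + 1) * F (t - t^g) ≤ (k+1) * F t + η * F t := by
        calc (k + 1) * F (t - t^g) ≤ (k+1) * ((1 + κ) * F t) := by gcongr
          _ = (k+1) * F t + ((k+1) * κ) * F t := by ring
          _ ≤ _ := by gcongr
      have j4 : η * F (t - t^g) ≤ η * (2 * F t) := by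
        gcongr
        nlinarith
      have hfold : μ.real {ω | t - t^g < ((∑ i ∈ Finset.range k, X i ω : ℕ) : ℝ)} = P (t - t^g) := rfl
      rw [hfold] at h1
      have hk1 : ((k+1:ℕ):ℝ) = k+1 := by push_cast; ring
      rw [hk1]
      have e1 : ε * F t = 8 * (η * F t) := by rw [hη]; ring
      have e2 : 0 < η * F t := by positivity
      linarith


theorem gw_meas_rand {α : Type*} {mα : MeasurableSpace α} {N : α → ℕ} {Y : ℕ → α → ℕ} (hN : Measurable N)
    (hY : ∀ k, Measurable (Y k)) : Measurable (fun a => Y (N a) a) := by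
  have : Measurable (fun p : ℕ × α => Y p.1 p.2) := measurable_from_prod_countable_right hY
  exact this.comp (hN.prodMk measurable_id)

/-- A random sum with independent index. -/
structure GWRS {Ω : Type*} [MeasurableSpace Ω] (μ : Measure Ω) (ν : Measure ℕ) (X : ℕ → Ω → ℕ)
    (N T : Ω → ℕ) (M : ℝ) : Prop where
  iid : GWIid μ ν X
  measN : Measurable N
  ind : ∀ k, IndepFun N (fun ω => ∑ i ∈ Finset.range k, X i ω) μ
  eq : ∀ ω, T ω = ∑ i ∈ Finset.range (N ω), X i ω
  mean : HasSum (fun k : ℕ => μ.real {ω | N ω = k} * k) M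

section
variable {Ω : Type*} [MeasurableSpace Ω] {μ : Measure Ω} [IsProbabilityMeasure μ] {ν : Measure ℕ}
  {X : ℕ → Ω → ℕ} {N T : Ω → ℕ} {M : ℝ}

theorem GWRS.hasSum (h : GWRS μ ν X N T M) (s B : Set ℕ) [DecidablePred (· ∈ s)] :
    HasSum (fun k : ℕ => if k ∈ s then
      μ.real {ω | N ω = k} * μ.real {ω | (∑ i ∈ Finset.range k, X i ω) ∈ B} else 0)
      (μ.real {ω | N ω ∈ s ∧ T ω ∈ B}) := by
  set A : ℕ → Set Ω := fun k => if k ∈ s then {ω | N ω = k} ∩ {ω | (∑ i ∈ Finset.range k, X i ω) ∈ B} else ∅ with hA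
  have hU : {ω | N ω ∈ s ∧ T ω ∈ B} = ⋃ k, A k := by
    ext ω
    simp only [Set.mem_ofPred_eq, Set.mem_iUnion, hA, h.eq]
    constructor
    · rintro ⟨h1, h2⟩
      refine ⟨N ω, ?_⟩
      rw [if_pos h1]
      exact ⟨rfl, h2⟩
    · rintro ⟨k, hk⟩
      split_ifs at hk with hks
      · obtain ⟨h1, h2⟩ := hk
        have h1 : N ω = k := h1
        subst h1
        exact ⟨hks, h2⟩
      · exact hk.elim
  have hd : Pairwise (Function.onFun Disjoint A) := by
    intro i j hij
    simp only [Function.onFun, hA]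
    rw [Set.disjoint_left]
    intro ω hi hj
    split_ifs at hi hj
    · have h1 : N ω = i := hi.1
      have h2 : N ω = j := hj.1
      exact hij (h1.symm.trans h2)
    all_goals first | exact hi.elim | exact hj.elim
  have hSm : ∀ k, Measurable (fun ω => ∑ i ∈ Finset.range k, X i ω) := fun k =>
    Finset.measurable_sum _ (fun i _ => h.iid.meas i)
  have hm : ∀ k, MeasurableSet (A k) := by
    intro k
    simp only [hA]
    split_ifs
    · exact (h.measN (MeasurableSet.singleton k)).inter (hSm k MeasurableSet.of_discrete)
    · exact MeasurableSet.empty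
  have h1 := measure_iUnion (μ := μ) hd hm
  have hfin : ∑' k, μ (A k) ≠ ⊤ := by rw [← h1]; exact measure_ne_top _ _
  have h2 := ENNReal.hasSum_toReal hfin
  rw [← ENNReal.tsum_toReal_eq (fun a => measure_ne_top _ _), ← h1, ← hU] at h2
  have h3 : HasSum (fun x => (μ (A x)).toReal) (μ.real {ω | N ω ∈ s ∧ T ω ∈ B}) := h2
  convert h3 using 1
  ext k
  simp only [hA]
  split_ifs
  · have := (h.ind k).measure_inter_preimage_eq_mul {k} B MeasurableSet.of_discrete MeasurableSet.of_discrete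
    have h3 := congrArg ENNReal.toReal this
    rw [ENNReal.toReal_mul] at h3
    exact h3.symm
  · simp

theorem GWRS.hasSum1 (h : GWRS μ ν X N T M) (s : Set ℕ) [DecidablePred (· ∈ s)] :
    HasSum (fun k : ℕ => if k ∈ s then μ.real {ω | N ω = k} else 0) (μ.real {ω | N ω ∈ s}) := by
  have := h.hasSum s Set.univ
  simpa using this

theorem GWRS.mixA (h : GWRS μ ν X N T M) (s B : Set ℕ) (q : ℝ)
    (hq : ∀ k ∈ s, μ.real {ω | (∑ i ∈ Finset.range k, X i ω) ∈ B} ≤ q) :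
    μ.real {ω | N ω ∈ s ∧ T ω ∈ B} ≤ μ.real {ω | N ω ∈ s} * q := by
  classical
  refine hasSum_le ?_ (h.hasSum s B) ((h.hasSum1 s).mul_right q)
  intro k
  split_ifs with hk
  · exact mul_le_mul_of_nonneg_left (hq k hk) measureReal_nonneg
  · simp

theorem GWRS.mixC (h : GWRS μ ν X N T M) (s B : Set ℕ) (c : ℝ) (hc : 0 ≤ c)
    (hq : ∀ k ∈ s, μ.real {ω | (∑ i ∈ Finset.range k, X i ω) ∈ B} ≤ c * k) :
    μ.real {ω | N ω ∈ s ∧ T ω ∈ B} ≤ M * c := by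
  classical
  refine hasSum_le ?_ (h.hasSum s B) (h.mean.mul_right c)
  intro k
  split_ifs with hk
  · rw [mul_assoc, mul_comm (k:ℝ) c]
    exact mul_le_mul_of_nonneg_left (hq k hk) measureReal_nonneg
  · positivity

/-- With the index set above `K`. -/
theorem GWRS.mixK (h : GWRS μ ν X N T M) (s B : Set ℕ) (c : ℝ) (hc : 0 ≤ c) (K : ℕ) (hs : ∀ k ∈ s, K ≤ k)
    (hq : ∀ k ∈ s, μ.real {ω | (∑ i ∈ Finset.range k, X i ω) ∈ B} ≤ c * k) :
    μ.real {ω | N ω ∈ s ∧ T ω ∈ B} ≤ (M - ∑ k ∈ Finset.range K, μ.real {ω | N ω = k} * k) * c := by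
  classical
  have h1 : HasSum (fun k : ℕ => if k ∈ Finset.range K then μ.real {ω | N ω = k} * k else 0)
      (∑ k ∈ Finset.range K, μ.real {ω | N ω = k} * k) := by
    have := hasSum_sum_of_ne_finset_zero (L := SummationFilter.unconditional ℕ) (f := fun k : ℕ => if k ∈ Finset.range K then μ.real {ω | N ω = k} * k else 0)
      (s := Finset.range K) (fun b hb => if_neg hb)
    convert this using 1
    exact Finset.sum_congr rfl (fun k hk => (if_pos hk).symm)
  refine hasSum_le ?_ (h.hasSum s B) ((h.mean.sub h1).mul_right c)
  intro k
  split_ifs with hk hk2 hk2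
  · exact absurd (hs k hk) (by simpa using hk2)
  · rw [sub_zero, mul_assoc, mul_comm (k:ℝ) c]
    exact mul_le_mul_of_nonneg_left (hq k hk) measureReal_nonneg
  · simp
  · rw [sub_zero]
    positivity

theorem GWRS.mixFin (h : GWRS μ ν X N T M) (B : Set ℕ) (K : ℕ) :
    μ.real {ω | N ω ∈ Set.Iio K ∧ T ω ∈ B} =
      ∑ k ∈ Finset.range K, μ.real {ω | N ω = k} * μ.real {ω | (∑ i ∈ Finset.range k, X i ω) ∈ B} := by
  classical
  have h1 := h.hasSum (Set.Iio K) B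
  have h2 := hasSum_sum_of_ne_finset_zero (L := SummationFilter.unconditional ℕ) (f := fun k : ℕ => if k ∈ Set.Iio K then
      μ.real {ω | N ω = k} * μ.real {ω | (∑ i ∈ Finset.range k, X i ω) ∈ B} else 0)
      (s := Finset.range K) (fun b hb => if_neg (by simpa using hb))
  rw [h1.unique h2]
  exact Finset.sum_congr rfl (fun k hk => if_pos (by simpa using hk))

theorem GWRS.sum_le (h : GWRS μ ν X N T M) (K : ℕ) : ∑ k ∈ Finset.range K, μ.real {ω | N ω = k} * k ≤ M :=
  sum_le_hasSum _ (fun k _ => by positivity) h.mean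

theorem GWRS.prob_le (h : GWRS μ ν X N T M) (K : ℕ) : ∑ k ∈ Finset.range K, μ.real {ω | N ω = k} ≤ 1 := by
  classical
  have := h.mixFin Set.univ K
  simp at this
  have h2 : μ.real {ω | N ω < K} ≤ 1 := measureReal_le_one
  linarith

theorem GWRS.measT (h : GWRS μ ν X N T M) : Measurable T := by
  have : T = fun ω => ∑ i ∈ Finset.range (N ω), X i ω := funext h.eq
  rw [this]
  exact gw_meas_rand h.measN (Y := fun k ω => ∑ i ∈ Finset.range k, X i ω)
    (fun k => Finset.measurable_sum _ (fun i _ => h.iid.meas i))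

theorem gw_lint_nat {N : Ω → ℕ} (hN : Measurable N) :
    ∫⁻ ω, (N ω : ENNReal) ∂μ = ∑' k : ℕ, μ {ω | N ω = k} * (k : ENNReal) := by
  have h1 := lintegral_map (μ := μ) (f := fun k : ℕ => (k : ENNReal)) (g := N) (by fun_prop) hN
  rw [← h1, lintegral_countable']
  refine tsum_congr (fun k => ?_)
  rw [Measure.map_apply hN (MeasurableSet.singleton k), mul_comm]
  rfl

theorem gw_hasSum_of_lint {N : Ω → ℕ} (hN : Measurable N) {M : ℝ} (hM : 0 ≤ M)
    (h : ∫⁻ ω, (N ω : ENNReal) ∂μ = ENNReal.ofReal M) :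
    HasSum (fun k : ℕ => μ.real {ω | N ω = k} * k) M := by
  rw [gw_lint_nat hN] at h
  have h2 := ENNReal.hasSum_toReal (f := fun k : ℕ => μ {ω | N ω = k} * (k : ENNReal)) (by rw [h]; exact ENNReal.ofReal_ne_top)
  rw [← ENNReal.tsum_toReal_eq (fun a => ENNReal.mul_ne_top (measure_ne_top _ _) (by simp)), h,
    ENNReal.toReal_ofReal hM] at h2
  convert h2 using 1
  ext k
  rw [ENNReal.toReal_mul]
  simp [Measure.real]

theorem gw_lint_of_hasSum {N : Ω → ℕ} (hN : Measurable N) {M : ℝ}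
    (h : HasSum (fun k : ℕ => μ.real {ω | N ω = k} * k) M) :
    ∑' k : ℕ, μ {ω | N ω = k} * (k : ENNReal) = ENNReal.ofReal M := by
  rw [← h.tsum_eq, ENNReal.ofReal_tsum_of_nonneg (fun k => by positivity) h.summable]
  refine tsum_congr (fun k => ?_)
  rw [ENNReal.ofReal_mul measureReal_nonneg]
  simp [Measure.real]

theorem gw_lint_X {F : ℝ → ℝ} {m : ℝ} (hX : GWIid μ ν X) (hL : GWLaw ν F m) (i : ℕ) :
    ∫⁻ ω, (X i ω : ENNReal) ∂μ = ENNReal.ofReal m := by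
  have h1 := lintegral_map (μ := μ) (f := fun k : ℕ => (k : ENNReal)) (g := X i) (by fun_prop) (hX.meas i)
  rw [← h1, hX.law i, hL.mean, ofReal_integral_eq_lintegral_ofReal hL.int1 (Eventually.of_forall (fun k => Nat.cast_nonneg k))]
  simp

theorem gw_lint_S {F : ℝ → ℝ} {m : ℝ} (hX : GWIid μ ν X) (hL : GWLaw ν F m) (k : ℕ) :
    ∫⁻ ω, ((∑ i ∈ Finset.range k, X i ω : ℕ) : ENNReal) ∂μ = k * ENNReal.ofReal m := by
  push_cast
  rw [lintegral_finsetSum _ (fun i _ => by have := hX.meas i; fun_prop)]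
  simp [gw_lint_X hX hL]

theorem GWRS.meanT {F : ℝ → ℝ} {m : ℝ} (h : GWRS μ ν X N T M) (hL : GWLaw ν F m) (hm : 0 ≤ m) :
    HasSum (fun k : ℕ => μ.real {ω | T ω = k} * k) (M * m) := by
  have hM : 0 ≤ M := h.mean.nonneg (fun k => by positivity)
  refine gw_hasSum_of_lint h.measT (by positivity) ?_
  have hSm : ∀ k, Measurable (fun ω => ∑ i ∈ Finset.range k, X i ω) := fun k =>
    Finset.measurable_sum _ (fun i _ => h.iid.meas i)
  set I : ℕ → ℕ → ENNReal := fun k j => if j = k then 1 else 0 with hI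
  have e : ∀ ω, (T ω : ENNReal) = ∑' k : ℕ, I k (N ω) * ((∑ i ∈ Finset.range k, X i ω : ℕ) : ENNReal) := by
    intro ω
    rw [tsum_eq_single (N ω)]
    · simp [hI, h.eq]
    · intro k hk
      simp [hI, hk.symm]
  have hIm : ∀ k, Measurable (I k) := fun k => measurable_of_countable _
  simp_rw [e]
  rw [lintegral_tsum (fun k => by
    have := hSm k; have := hIm k; have := h.measN
    fun_prop)]
  have e2 : ∀ k : ℕ, ∫⁻ ω, I k (N ω) * ((∑ i ∈ Finset.range k, X i ω : ℕ) : ENNReal) ∂μ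
      = μ {ω | N ω = k} * (k : ENNReal) * ENNReal.ofReal m := by
    intro k
    have := hSm k; have h7 := hIm k; have := h.measN
    have hi : IndepFun (fun ω => I k (N ω)) (fun ω => ((∑ i ∈ Finset.range k, X i ω : ℕ) : ENNReal)) μ :=
      (h.ind k).comp (φ := I k) (ψ := fun j : ℕ => (j : ENNReal)) h7 (measurable_of_countable _)
    have h8 := lintegral_mul_eq_lintegral_mul_lintegral_of_indepFun (by fun_prop) (by fun_prop) hi
    simp only [Pi.mul_apply] at h8
    rw [h8, gw_lint_S h.iid hL, mul_assoc]
    congr 1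
    have : (fun ω => I k (N ω)) = Set.indicator {ω | N ω = k} 1 := by
      ext ω; simp [hI, Set.indicator_apply]
    rw [this, lintegral_indicator_one]
    exact h.measN (MeasurableSet.singleton k)
  simp_rw [e2]
  rw [ENNReal.tsum_mul_right, gw_lint_of_hasSum h.measN h.mean, ENNReal.ofReal_mul hM]
end


theorem gw_Z_past {Ω : Type*} {ξ : ℕ → ℕ → Ω → ℕ} {Z : ℕ → Ω → ℕ}
    (hZ0 : ∀ ω, Z 0 ω = 1) (hZrec : ∀ n ω, Z (n + 1) ω = ∑ i ∈ Finset.range (Z n ω), ξ n i ω) (n : ℕ) :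
    Measurable[⨆ p ∈ {p : ℕ × ℕ | p.1 < n}, MeasurableSpace.comap (ξ p.1 p.2) ⊤] (Z n) := by
  induction n with
  | zero =>
    have : Z 0 = fun _ => 1 := funext hZ0
    rw [this]
    exact measurable_const
  | succ n ih =>
    have : Z (n+1) = fun ω => ∑ i ∈ Finset.range (Z n ω), ξ n i ω := funext (hZrec n)
    rw [this]
    refine gw_meas_rand (Y := fun k ω => ∑ i ∈ Finset.range k, ξ n i ω) ?_ ?_
    · refine ih.mono ?_ le_rfl
      refine biSup_mono ?_
      intro p hp
      exact Nat.lt_succ_of_lt hp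
    · intro k
      refine Finset.measurable_sum _ (fun i _ => ?_)
      have h1 : MeasurableSpace.comap (ξ n i) ⊤ ≤ ⨆ p ∈ {p : ℕ × ℕ | p.1 < n+1}, MeasurableSpace.comap (ξ p.1 p.2) ⊤ :=
        le_biSup (fun p : ℕ × ℕ => MeasurableSpace.comap (ξ p.1 p.2) ⊤) (i := (n, i)) (Nat.lt_succ_self n)
      exact (comap_measurable (ξ n i)).mono h1 le_rfl

theorem gw_rs {Ω : Type*} [MeasurableSpace Ω] {μ : Measure Ω} [IsProbabilityMeasure μ]
    {ξ : ℕ → ℕ → Ω → ℕ} {ν : Measure ℕ} {F : ℝ → ℝ} {m : ℝ} (hL : GWLaw ν F m) (hm : 0 ≤ m)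
    (hmeas : ∀ n i, Measurable (ξ n i))
    (hindep : iIndepFun (fun p : ℕ × ℕ => ξ p.1 p.2) μ)
    (hident : ∀ n i, Measure.map (ξ n i) μ = ν)
    {Z : ℕ → Ω → ℕ}
    (hZ0 : ∀ ω, Z 0 ω = 1) (hZrec : ∀ n ω, Z (n + 1) ω = ∑ i ∈ Finset.range (Z n ω), ξ n i ω) (n : ℕ) :
    GWRS μ ν (ξ n) (Z n) (Z (n+1)) (m ^ n) := by
  have hle : ∀ p : ℕ × ℕ, MeasurableSpace.comap (ξ p.1 p.2) ⊤ ≤ ‹MeasurableSpace Ω› :=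
    fun p => (hmeas p.1 p.2).comap_le
  have iid : ∀ n, GWIid μ ν (ξ n) := fun n => ⟨hmeas n,
    hindep.precomp (g := fun i : ℕ => (n, i)) (fun a b h => (Prod.mk.inj h).2), hident n⟩
  have mZ : ∀ n, Measurable (Z n) := fun n => (gw_Z_past hZ0 hZrec n).mono (iSup₂_le (fun p _ => hle p)) le_rfl
  have hind : ∀ n k, IndepFun (Z n) (fun ω => ∑ i ∈ Finset.range k, ξ n i ω) μ := by
    intro n k
    have h1 := indep_iSup_of_disjoint hle ((iIndepFun_iff_iIndep _ _ _).1 hindep)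
      (S := {p : ℕ × ℕ | p.1 < n}) (T := {p : ℕ × ℕ | p.1 = n})
      (Set.disjoint_left.2 (fun p h1 h2 => by
        have h1 : p.1 < n := h1
        have h2 : p.1 = n := h2
        omega))
    rw [IndepFun_iff_Indep]
    refine indep_of_indep_of_le_left (indep_of_indep_of_le_right h1 ?_) ?_
    · rw [← measurable_iff_comap_le]
      refine Finset.measurable_sum _ (fun i _ => ?_)
      have h1 : MeasurableSpace.comap (ξ n i) ⊤ ≤ ⨆ p ∈ {p : ℕ × ℕ | p.1 = n}, MeasurableSpace.comap (ξ p.1 p.2) ⊤ :=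
        le_biSup (fun p : ℕ × ℕ => MeasurableSpace.comap (ξ p.1 p.2) ⊤) (i := (n, i)) rfl
      exact (comap_measurable (ξ n i)).mono h1 le_rfl
    · rw [← measurable_iff_comap_le]
      exact gw_Z_past hZ0 hZrec n
  induction n with
  | zero =>
    refine ⟨iid 0, mZ 0, hind 0, hZrec 0, ?_⟩
    refine gw_hasSum_of_lint (mZ 0) (by simp) ?_
    simp [hZ0]
  | succ n ih =>
    refine ⟨iid _, mZ _, hind _, hZrec _, ?_⟩
    rw [pow_succ]
    exact ih.meanT hL hm


section
variable {Ω : Type*} [MeasurableSpace Ω] {μ : Measure Ω} [IsProbabilityMeasure μ] {ν : Measure ℕ}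
  {X : ℕ → Ω → ℕ} {N T : Ω → ℕ} {M V m C : ℝ} {F : ℝ → ℝ}

theorem gw_step_U (h : GWRS μ ν X N T M) (hM : 0 < M) (hm : 1 < m) (hV : 0 ≤ V)
    (hch : ∀ k : ℕ, ∀ a > 0, μ.real {ω | a ≤ |((∑ i ∈ Finset.range k, X i ω : ℕ) : ℝ) - k * m|} ≤ k * V / a ^ 2)
    {a b : ℝ} (hb : 1 ≤ b) (hab : a < b) :
    μ.real {ω | M * m * b < T ω} ≤ μ.real {ω | M * a < N ω}
      + μ.real {ω | N ω ∈ {k : ℕ | (k:ℝ) ≤ M * (b / 2)} ∧ T ω ∈ {k : ℕ | M * m * b < k}}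
      + μ.real {ω | M * (b / 2) < N ω} * (b * V / (M * (b - a) ^ 2)) := by
  set s : Set ℕ := {k : ℕ | M * (b/2) < k ∧ k ≤ M * a} with hs
  set B : Set ℕ := {k : ℕ | M * m * b < k} with hB
  have hd : 0 < b - a := by linarith
  have hq0 : 0 ≤ b * V / (M * (b - a) ^ 2) := by positivity
  have h1 := h.mixA s B (b * V / (M * (b - a) ^ 2)) (by
    rintro k ⟨hk1, hk2⟩
    have hpos : 0 < M * m * (b - a) := by positivity
    refine le_trans (measureReal_mono ?_) ((hch k (M * m * (b - a)) hpos).trans ?_)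
    · intro ω hω
      have hω : M * m * b < ((∑ i ∈ Finset.range k, X i ω : ℕ) : ℝ) := hω
      simp only [Set.mem_ofPred_eq]
      refine le_trans ?_ (le_abs_self _)
      have : k * m ≤ M * a * m := by gcongr
      linarith
    · have hk3 : (k:ℝ) ≤ M * b := hk2.trans (by gcongr)
      calc k * V / (M * m * (b - a)) ^ 2 ≤ (M * b) * V / (M * 1 * (b - a)) ^ 2 := by gcongr
        _ = _ := by field_simp)
  have h2 : μ.real {ω | N ω ∈ s} ≤ μ.real {ω | M * (b / 2) < N ω} := measureReal_mono (fun ω hω => hω.1)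
  have hsub : {ω | M * m * b < T ω} ⊆ ({ω | M * a < N ω} ∪
      {ω | N ω ∈ {k : ℕ | (k:ℝ) ≤ M * (b / 2)} ∧ T ω ∈ B}) ∪ {ω | N ω ∈ s ∧ T ω ∈ B} := by
    intro ω hω
    have hω : M * m * b < T ω := hω
    by_cases c1 : M * a < N ω
    · exact Or.inl (Or.inl c1)
    by_cases c2 : (N ω : ℝ) ≤ M * (b/2)
    · exact Or.inl (Or.inr ⟨c2, hω⟩)
    · exact Or.inr ⟨⟨not_le.1 c2, not_lt.1 c1⟩, hω⟩
  refine (measureReal_mono hsub).trans ((measureReal_union_le _ _).trans ?_)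
  refine add_le_add (measureReal_union_le _ _) (h1.trans ?_)
  gcongr

theorem gw_step_nag (h : GWRS μ ν X N T M) (hM : 1 ≤ M) (hm : 1 < m) (hC : 0 ≤ C) (hF : ∀ t, 0 < F t)
    (hnag : ∀ k : ℕ, ∀ t ≥ (1:ℝ), k * m ≤ 2 / 3 * t →
      μ.real {ω | t < ((∑ i ∈ Finset.range k, X i ω : ℕ) : ℝ)} ≤ C * k * F t)
    {b : ℝ} (hb : 1 ≤ b) (K : ℕ) :
    μ.real {ω | N ω ∈ {k : ℕ | K ≤ k ∧ (k:ℝ) ≤ M * (b / 2)} ∧ T ω ∈ {k : ℕ | M * m * b < k}} ≤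
      (M - ∑ k ∈ Finset.range K, μ.real {ω | N ω = k} * k) * (C * F (M * m * b)) := by
  have ht : 1 ≤ M * m * b := one_le_mul_of_one_le_of_one_le (one_le_mul_of_one_le_of_one_le hM hm.le) hb
  refine h.mixK _ _ _ (mul_nonneg hC (hF _).le) K (fun k hk => hk.1) ?_
  rintro k ⟨hk1, hk2⟩
  have := hnag k (M * m * b) ht (by
    have : k * m ≤ M * (b / 2) * m := by gcongr
    have h2 : 0 < M * m * b := by linarith
    linarith)
  calc _ ≤ C * k * F (M * m * b) := this
    _ = _ := by ring

theorem gw_step_L (h : GWRS μ ν X N T M) (hM : 0 < M) (hm : 1 < m) (hV : 0 ≤ V)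
    (hch : ∀ k : ℕ, ∀ a > 0, μ.real {ω | a ≤ |((∑ i ∈ Finset.range k, X i ω : ℕ) : ℝ) - k * m|} ≤ k * V / a ^ 2)
    {a b : ℝ} (ha : 0 < a) (hab : a < b) :
    μ.real {ω | M * b < N ω} - μ.real {ω | M * b < N ω} * (b * V / (M * (b - a) ^ 2)) ≤
      μ.real {ω | N ω ∈ {k : ℕ | M * b < k} ∧ T ω ∈ {k : ℕ | M * m * a < k}} := by
  set s : Set ℕ := {k : ℕ | M * b < k} with hs
  set B : Set ℕ := {k : ℕ | (k:ℝ) ≤ M * m * a} with hB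
  have hd : 0 < b - a := by linarith
  have h1 := h.mixA s B (b * V / (M * (b - a) ^ 2)) (by
    intro k hk
    have hk : M * b < k := hk
    have hka : M * a < k := lt_trans (by gcongr) hk
    have hpos : 0 < (k - M * a) * m := mul_pos (by linarith) (by linarith)
    refine le_trans (measureReal_mono ?_) ((hch k ((k - M * a) * m) hpos).trans ?_)
    · intro ω hω
      have hω : ((∑ i ∈ Finset.range k, X i ω : ℕ) : ℝ) ≤ M * m * a := hω
      simp only [Set.mem_ofPred_eq]
      refine le_trans ?_ (neg_le_abs _)
      linarith
    · have hd2 : 0 < (k:ℝ) - M * a := by linarith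
      have hk0 : (0:ℝ) ≤ k := Nat.cast_nonneg k
      calc k * V / ((k - M * a) * m) ^ 2 ≤ k * V / ((k - M * a) * 1) ^ 2 := by gcongr
        _ ≤ b * V / (M * (b - a) ^ 2) := by
          rw [mul_one, div_le_div_iff₀ (by positivity) (by positivity)]
          have hb : 0 < b := ha.trans hab
          have key : k * (M * (b - a)^2) ≤ b * (k - M * a)^2 := by
            have h3 : 0 ≤ (k - M * b) * (k * b - M * a^2) := by
              apply mul_nonneg (by linarith)
              have : M * a ^ 2 ≤ k * b := by
                calc M * a^2 = M * a * a := by ring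
                  _ ≤ k * b := by gcongr
              linarith
            nlinarith
          calc k * V * (M * (b - a)^2) = V * (k * (M * (b - a)^2)) := by ring
            _ ≤ V * (b * (k - M * a)^2) := by gcongr
            _ = _ := by ring)
  have hsub : {ω | M * b < N ω} ⊆ {ω | N ω ∈ s ∧ T ω ∈ {k : ℕ | M * m * a < k}} ∪ {ω | N ω ∈ s ∧ T ω ∈ B} := by
    intro ω hω
    by_cases c : M * m * a < T ω
    · exact Or.inl ⟨hω, c⟩
    · exact Or.inr ⟨hω, not_lt.1 c⟩
  have h2 := (measureReal_mono (μ := μ) hsub).trans (measureReal_union_le _ _)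
  have h3 : μ.real {ω | N ω ∈ s} = μ.real {ω | M * b < N ω} := rfl
  rw [h3] at h1
  linarith

theorem gw_step_K (h : GWRS μ ν X N T M) {δ : ℝ} (hδ : 0 < δ) :
    ∃ K : ℕ, M - δ ≤ ∑ k ∈ Finset.range K, μ.real {ω | N ω = k} * k := by
  have := h.mean.tendsto_sum_nat
  obtain ⟨K, hK⟩ := (this.eventually (lt_mem_nhds (show M - δ < M by linarith))).exists
  exact ⟨K, hK.le⟩

theorem gw_step_fin {g : ℝ} (hF : GWTail F m g) (hL : GWLaw ν F m) (h : GWRS μ ν X N T M)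
    {ε : ℝ} (hε : 0 < ε) (K : ℕ) : ∀ᶠ t : ℝ in atTop,
    (∑ k ∈ Finset.range K, μ.real {ω | N ω = k} * k - ε) * F t ≤
      μ.real {ω | N ω ∈ Set.Iio K ∧ T ω ∈ {k : ℕ | t < k}} ∧
    μ.real {ω | N ω ∈ Set.Iio K ∧ T ω ∈ {k : ℕ | t < k}} ≤ (M + ε) * F t := by
  have h1 : ∀ᶠ t : ℝ in atTop, ∀ k ∈ Finset.range K, 
      k * F t - ε * F t ≤ μ.real {ω | t < ((∑ i ∈ Finset.range k, X i ω : ℕ) : ℝ)} ∧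
      μ.real {ω | t < ((∑ i ∈ Finset.range k, X i ω : ℕ) : ℝ)} ≤ k * F t + ε * F t := by
    rw [Filter.eventually_all_finset]
    intro k _
    exact gw_subexp hF hL h.iid k ε hε
  filter_upwards [h1] with t ht
  have hmf := h.mixFin {k : ℕ | t < k} K
  simp only [Set.mem_ofPred_eq] at hmf ⊢
  rw [hmf]
  have hFt := hF.pos t
  have hp := h.prob_le K
  have hs := h.sum_le K
  constructor
  · have h2 : ∑ k ∈ Finset.range K, μ.real {ω | N ω = k} * (k * F t - ε * F t) ≤
        ∑ k ∈ Finset.range K, μ.real {ω | N ω = k} * μ.real {ω | (∑ i ∈ Finset.range k, X i ω) ∈ {k : ℕ | t < k}} :=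
      Finset.sum_le_sum (fun k hk => mul_le_mul_of_nonneg_left (ht k hk).1 measureReal_nonneg)
    refine le_trans ?_ h2
    have e : ∑ k ∈ Finset.range K, μ.real {ω | N ω = k} * (k * F t - ε * F t) =
      (∑ k ∈ Finset.range K, μ.real {ω | N ω = k} * k) * F t - (∑ k ∈ Finset.range K, μ.real {ω | N ω = k}) * (ε * F t) := by
      rw [Finset.sum_mul, Finset.sum_mul, ← Finset.sum_sub_distrib]
      exact Finset.sum_congr rfl (fun k _ => by ring)
    rw [e]
    have : (∑ k ∈ Finset.range K, μ.real {ω | N ω = k}) * (ε * F t) ≤ 1 * (ε * F t) := by gcongr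
    linarith
  · have h2 : ∑ k ∈ Finset.range K, μ.real {ω | N ω = k} * μ.real {ω | (∑ i ∈ Finset.range k, X i ω) ∈ {k : ℕ | t < k}} ≤ 
       ∑ k ∈ Finset.range K, μ.real {ω | N ω = k} * (k * F t + ε * F t) :=
      Finset.sum_le_sum (fun k hk => mul_le_mul_of_nonneg_left (ht k hk).2 measureReal_nonneg)
    refine le_trans h2 ?_
    have e : ∑ k ∈ Finset.range K, μ.real {ω | N ω = k} * (k * F t + ε * F t) =
      (∑ k ∈ Finset.range K, μ.real {ω | N ω = k} * k) * F t + (∑ k ∈ Finset.range K, μ.real {ω | N ω = k}) * (ε * F t) := by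
      rw [Finset.sum_mul, Finset.sum_mul, ← Finset.sum_add_distrib]
      exact Finset.sum_congr rfl (fun k _ => by ring)
    rw [e]
    have : (∑ k ∈ Finset.range K, μ.real {ω | N ω = k}) * (ε * F t) ≤ 1 * (ε * F t) := by gcongr
    have : (∑ k ∈ Finset.range K, μ.real {ω | N ω = k} * k) * F t ≤ M * F t := by gcongr
    linarith

end

theorem gw_step {Ω : Type*} [MeasurableSpace Ω] {μ : Measure Ω} [IsProbabilityMeasure μ] {ν : Measure ℕ}
    {F : ℝ → ℝ} {m g : ℝ} (hF : GWTail F m g) (hL : GWLaw ν F m) {ξ : ℕ → ℕ → Ω → ℕ} {Z : ℕ → Ω → ℕ}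
    (hZ0 : ∀ ω, Z 0 ω = 1) (hrs : ∀ n, GWRS μ ν (ξ n) (Z n) (Z (n+1)) (m ^ n)) :
    ∃ V C x0, GWStep F m (fun n x => μ.real {ω | m ^ n * x < Z n ω}) V C x0 := by
  obtain ⟨V, hV, hch⟩ := gw_cheb (μ := μ) hL
  obtain ⟨C, hC, hnag⟩ := gw_nagaev (μ := μ) hF hL
  have hm := hF.one_lt
  have hM : ∀ n, 1 ≤ m ^ n := fun n => one_le_pow₀ hm.le
  have hM0 : ∀ n, 0 < m ^ n := fun n => by linarith [hM n]
  refine ⟨V, C, 1, ?_⟩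
  refine ⟨?_, fun _ _ => measureReal_nonneg, fun _ _ => measureReal_le_one, ?_, hV, hC, ?_, ?_, ?_, ?_⟩
  · intro n x y hxy
    refine measureReal_mono ?_
    intro ω hω
    have hω : m ^ n * y < Z n ω := hω
    have := hM0 n
    exact lt_of_le_of_lt (by gcongr) hω
  · intro x hx
    have : {ω | m ^ 0 * x < (Z 0 ω : ℝ)} = ∅ := by
      ext ω; simp [hZ0]; linarith
    simp only [this, measureReal_empty]
  · intro n a b hb hab
    have h1 := gw_step_U (hrs n) (hM0 n) hm hV (hch _ (hrs n).iid) hb hab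
    have h2 := gw_step_nag (hrs n) (hM n) hm hC hF.pos (hnag _ (hrs n).iid) hb 0
    simp only [zero_le, true_and, Finset.range_zero, Finset.sum_empty, sub_zero] at h2
    rw [← pow_succ] at h1 h2
    linarith
  · intro n a b ha hab
    have h1 := gw_step_L (hrs n) (hM0 n) hm hV (hch _ (hrs n).iid) ha hab
    rw [← pow_succ] at h1
    refine h1.trans (measureReal_mono (fun ω hω => hω.2))
  · intro n ε hε
    set δ := ε / (2 * (C + 1)) with hδ
    have hδ0 : 0 < δ := by positivity
    have hδC : δ * C ≤ ε / 2 := by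
      have : δ * (C + 1) = ε / 2 := by rw [hδ]; field_simp
      linarith
    obtain ⟨K, hK⟩ := gw_step_K (hrs n) hδ0
    obtain ⟨t0, ht0⟩ := eventually_atTop.1 (gw_step_fin hF hL (hrs n) (half_pos hε) K)
    refine ⟨max 1 t0, fun b hb a hab => ?_⟩
    have hb1 : 1 ≤ b := (le_max_left _ _).trans hb
    have hbt : t0 ≤ m ^ (n+1) * b := ((le_max_right _ _).trans hb).trans (le_mul_of_one_le_left (by linarith) (hM _))
    have h1 := gw_step_U (hrs n) (hM0 n) hm hV (hch _ (hrs n).iid) hb1 hab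
    have h2 := gw_step_nag (hrs n) (hM n) hm hC hF.pos (hnag _ (hrs n).iid) hb1 K
    have h3 := (ht0 _ hbt).2
    rw [← pow_succ] at h1 h2
    have hFt := hF.pos (m ^ (n+1) * b)
    have h4 : μ.real {ω | Z n ω ∈ {k : ℕ | (k:ℝ) ≤ m ^ n * (b / 2)} ∧ Z (n+1) ω ∈ {k : ℕ | m ^ (n+1) * b < k}} ≤
        μ.real {ω | Z n ω ∈ Set.Iio K ∧ Z (n+1) ω ∈ {k : ℕ | m ^ (n+1) * b < k}} +
        μ.real {ω | Z n ω ∈ {k : ℕ | K ≤ k ∧ (k:ℝ) ≤ m ^ n * (b / 2)} ∧ Z (n+1) ω ∈ {k : ℕ | m ^ (n+1) * b < k}} := by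
      refine (measureReal_mono ?_).trans (measureReal_union_le _ _)
      rintro ω ⟨h5, h6⟩
      rcases lt_or_ge (Z n ω) K with h7 | h7
      · exact Or.inl ⟨h7, h6⟩
      · exact Or.inr ⟨⟨h7, h5⟩, h6⟩
    have h5 : (m ^ n - ∑ k ∈ Finset.range K, μ.real {ω | Z n ω = k} * k) * (C * F (m ^ (n+1) * b)) ≤
        ε / 2 * F (m ^ (n+1) * b) := by
      calc _ ≤ δ * (C * F (m ^ (n+1) * b)) := by
            apply mul_le_mul_of_nonneg_right _ (by positivity)
            linarith
        _ = (δ * C) * F (m ^ (n+1) * b) := by ring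
        _ ≤ _ := by gcongr
    linarith
  · intro n ε hε
    obtain ⟨K, hK⟩ := gw_step_K (hrs n) (half_pos hε)
    obtain ⟨t0, ht0⟩ := eventually_atTop.1 (gw_step_fin hF hL (hrs n) (half_pos hε) K)
    refine ⟨max (max 1 K) t0, fun a ha b hab => ?_⟩
    have ha1 : 1 ≤ a := ((le_max_left _ _).trans (le_max_left _ _)).trans ha
    have haK : K ≤ a := ((le_max_right _ _).trans (le_max_left _ _)).trans ha
    have hat : t0 ≤ m ^ (n+1) * a := ((le_max_right _ _).trans ha).trans (le_mul_of_one_le_left (by linarith) (hM _))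
    have h1 := gw_step_L (hrs n) (hM0 n) hm hV (hch _ (hrs n).iid) (by linarith) hab
    have h3 := (ht0 _ hat).1
    rw [← pow_succ] at h1
    have hFt := hF.pos (m ^ (n+1) * a)
    have h5 : (m ^ n - ε) * F (m ^ (n+1) * a) ≤ 
        (∑ k ∈ Finset.range K, μ.real {ω | Z n ω = k} * k - ε / 2) * F (m ^ (n+1) * a) := by
      apply mul_le_mul_of_nonneg_right _ hFt.le
      linarith
    have hmeasset : MeasurableSet {ω | Z n ω ∈ {k : ℕ | m ^ n * b < k} ∧ Z (n+1) ω ∈ {k : ℕ | m ^ (n+1) * a < k}} :=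
      ((hrs n).measN (MeasurableSet.of_discrete (s := {k : ℕ | m ^ n * b < k}))).inter
        ((hrs n).measT (MeasurableSet.of_discrete (s := {k : ℕ | m ^ (n+1) * a < k})))
    have hdisj : Disjoint {ω | Z n ω ∈ Set.Iio K ∧ Z (n+1) ω ∈ {k : ℕ | m ^ (n+1) * a < k}}
        {ω | Z n ω ∈ {k : ℕ | m ^ n * b < k} ∧ Z (n+1) ω ∈ {k : ℕ | m ^ (n+1) * a < k}} := by
      rw [Set.disjoint_left]
      rintro ω ⟨h6, _⟩ ⟨h7, _⟩
      have h6 : Z n ω < K := h6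
      have h7 : m ^ n * b < Z n ω := h7
      have h8 : (Z n ω : ℝ) < K := by exact_mod_cast h6
      have h9 : b ≤ m ^ n * b := le_mul_of_one_le_left (by linarith) (hM _)
      linarith
    have h6 := measureReal_union (μ := μ) hdisj hmeasset
    have h7 : μ.real ({ω | Z n ω ∈ Set.Iio K ∧ Z (n+1) ω ∈ {k : ℕ | m ^ (n+1) * a < k}} ∪
        {ω | Z n ω ∈ {k : ℕ | m ^ n * b < k} ∧ Z (n+1) ω ∈ {k : ℕ | m ^ (n+1) * a < k}}) ≤
        μ.real {ω | m ^ (n+1) * a < Z (n+1) ω} := by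
      refine measureReal_mono ?_
      rintro ω (h | h)
      · exact h.2
      · exact h.2
    linarith


theorem gw_lim1 {Ω : Type*} [MeasurableSpace Ω] {μ : Measure Ω} [IsProbabilityMeasure μ]
    {W : ℕ → Ω → ℝ} {L : Ω → ℝ} (hl : ∀ᵐ ω ∂μ, Tendsto (fun n => W n ω) atTop (nhds (L ω)))
    (x B : ℝ) (h : ∀ᶠ n in atTop, μ.real {ω | x < W n ω} ≤ B) : μ.real {ω | x < L ω} ≤ B := by
  set A : ℕ → Set Ω := fun N => {ω | ∀ n ≥ N, x < W n ω} with hA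
  have hmono : Monotone A := fun i j hij ω hω n hn => hω n (hij.trans hn)
  have h1 := tendsto_measure_iUnion_atTop (μ := μ) hmono
  have h2 := (ENNReal.tendsto_toReal (measure_ne_top μ _)).comp h1
  have h3 : (μ (⋃ n, A n)).toReal ≤ B := by
    refine le_of_tendsto h2 ?_
    filter_upwards [h] with n hn
    refine le_trans ?_ hn
    exact measureReal_mono (fun ω hω => hω n le_rfl)
  refine le_trans ?_ h3
  refine ENNReal.toReal_mono (measure_ne_top _ _) (measure_mono_ae ?_)
  filter_upwards [hl] with ω hω hx
  obtain ⟨N, hN⟩ := eventually_atTop.1 (hω.eventually (lt_mem_nhds hx))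
  exact Set.mem_iUnion.2 ⟨N, hN⟩

theorem gw_lim2 {Ω : Type*} [MeasurableSpace Ω] {μ : Measure Ω} [IsProbabilityMeasure μ]
    {W : ℕ → Ω → ℝ} {L : Ω → ℝ} (hW : ∀ n, Measurable (W n))
    (hl : ∀ᵐ ω ∂μ, Tendsto (fun n => W n ω) atTop (nhds (L ω)))
    (x x' B : ℝ) (hx : x < x') (h : ∀ᶠ n in atTop, B ≤ μ.real {ω | x' < W n ω}) : B ≤ μ.real {ω | x < L ω} := by
  set A : ℕ → Set Ω := fun N => ⋃ n : ℕ, ⋃ (_ : N ≤ n), {ω | x' < W n ω} with hA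
  have hanti : Antitone A := by
    intro i j hij ω hω
    simp only [hA, Set.mem_iUnion] at hω ⊢
    obtain ⟨n, hn, h⟩ := hω
    exact ⟨n, hij.trans hn, h⟩
  have hmeas : ∀ N, MeasurableSet (A N) := fun N =>
    MeasurableSet.iUnion (fun n => MeasurableSet.iUnion (fun _ => measurableSet_lt measurable_const (hW n)))
  have h1 := tendsto_measure_iInter_atTop (μ := μ) (fun i => (hmeas i).nullMeasurableSet) hanti ⟨0, measure_ne_top _ _⟩
  have h2 := (ENNReal.tendsto_toReal (measure_ne_top μ _)).comp h1
  have h3 : B ≤ (μ (⋂ n, A n)).toReal := by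
    refine ge_of_tendsto h2 ?_
    filter_upwards [h] with n hn
    refine hn.trans ?_
    refine measureReal_mono (fun ω hω => ?_) (measure_ne_top _ _)
    simp only [hA, Set.mem_iUnion]
    exact ⟨n, le_rfl, hω⟩
  refine le_trans h3 ?_
  refine ENNReal.toReal_mono (measure_ne_top _ _) (measure_mono_ae ?_)
  filter_upwards [hl] with ω hω hx2
  have hx2 : ω ∈ ⋂ n, A n := hx2
  show x < L ω
  by_contra hc
  obtain ⟨N, hN⟩ := eventually_atTop.1 (hω.eventually (gt_mem_nhds (lt_of_le_of_lt (not_lt.1 hc) hx)))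
  have := Set.mem_iInter.1 hx2 N
  simp only [hA, Set.mem_iUnion] at this
  obtain ⟨n, hn, h4⟩ := this
  have h4 : x' < W n ω := h4
  exact absurd (hN n hn) (not_lt.2 h4.le)

/-- If `F` is dominated varying, satisfies condition (C),
has finite second moment and is `x^γ`-insensitive for some `γ > 1/2`, then
the asymptotics `ℙ(W_n > x) ~ ∑_{i=0}^{n-1} m^i F̄(m^{i+1} x)` holds
uniformly in `n ≥ 1`; moreover
`ℙ(W_n > x) ~ ∑_{i=0}^{∞} m^i F̄(m^{i+1} x)` as `x, n → ∞`, and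
`ℙ(W > x) ~ ∑_{i=0}^{∞} m^i F̄(m^{i+1} x)` as `x → ∞`. -/
theorem gw_sqrt_insensitive_asymptotics
    {Ω : Type*} [MeasurableSpace Ω] (μ : Measure Ω) [IsProbabilityMeasure μ]
    (ξ : ℕ → ℕ → Ω → ℕ)
    (hmeas : ∀ n i, Measurable (ξ n i))
    (hindep : iIndepFun
      (fun p : ℕ × ℕ => ξ p.1 p.2) μ)
    (hident : ∀ n i, Measure.map (ξ n i) μ = Measure.map (ξ 0 0) μ)
    (hint : Integrable (fun ω => (ξ 0 0 ω : ℝ)) μ)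
    (m : ℝ) (hm : m = ∫ ω, (ξ 0 0 ω : ℝ) ∂μ) (hm1 : 1 < m)
    (Z : ℕ → Ω → ℕ)
    (hZ0 : ∀ ω, Z 0 ω = 1)
    (hZrec : ∀ n ω, Z (n + 1) ω = ∑ i ∈ Finset.range (Z n ω), ξ n i ω)
    (W : ℕ → Ω → ℝ) (hW : ∀ n ω, W n ω = (Z n ω : ℝ) / m ^ n)
    (Fbar : ℝ → ℝ) (hFbar : ∀ x, Fbar x = (μ {ω | x < (ξ 0 0 ω : ℝ)}).toReal)
    (Wlim : Ω → ℝ)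
    (hWlim : ∀ᵐ ω ∂μ, Tendsto (fun n => W n ω) atTop (nhds (Wlim ω)))
    -- `F` is dominated varying
    (hDV : ∃ C : ℝ, ∀ x : ℝ, Fbar (x / 2) ≤ C * Fbar x)
    -- condition (C)
    (hC : ∃ δ > (0 : ℝ), ∃ c : ℝ, ∀ x > (1 : ℝ), ∀ y > (1 : ℝ),
      Fbar (x * y) ≤ c * Fbar x / y ^ (1 + δ))
    -- finite second moment
    (hmom2 : Integrable (fun ω => ((ξ 0 0 ω : ℝ)) ^ 2) μ)
    -- `F` is `x^γ`-insensitive for some `γ > 1/2`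
    (γ : ℝ) (hγ : 1 / 2 < γ)
    (hins : Tendsto (fun x : ℝ => Fbar (x + x ^ γ) / Fbar x) atTop (nhds 1)) :
    (∀ ε > (0 : ℝ), ∃ x₀ : ℝ, ∀ x ≥ x₀, ∀ n : ℕ, 1 ≤ n →
        |(μ {ω | x < W n ω}).toReal /
            (∑ i ∈ Finset.range n, m ^ i * Fbar (m ^ (i + 1) * x)) - 1| < ε) ∧
    (∀ ε > (0 : ℝ), ∃ x₀ : ℝ, ∃ N : ℕ, ∀ x ≥ x₀, ∀ n ≥ N,
        |(μ {ω | x < W n ω}).toReal /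
            (∑' i : ℕ, m ^ i * Fbar (m ^ (i + 1) * x)) - 1| < ε) ∧
    Tendsto (fun x : ℝ => (μ {ω | x < Wlim ω}).toReal /
        (∑' i : ℕ, m ^ i * Fbar (m ^ (i + 1) * x))) atTop (nhds 1) := by
  have hL : GWLaw (Measure.map (ξ 0 0) μ) Fbar m := by
    refine ⟨Measure.isProbabilityMeasure_map (hmeas 0 0).aemeasurable, ?_, ?_, ?_, ?_⟩
    · intro t
      rw [hFbar, measureReal_def, Measure.map_apply (hmeas 0 0) MeasurableSet.of_discrete]
      rfl
    · rw [integrable_map_measure (measurable_of_countable _).aestronglyMeasurable (hmeas 0 0).aemeasurable]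
      exact hint
    · rw [hm, integral_map (hmeas 0 0).aemeasurable (measurable_of_countable _).aestronglyMeasurable]
    · rw [integrable_map_measure (measurable_of_countable _).aestronglyMeasurable (hmeas 0 0).aemeasurable]
      exact hmom2
  have hanti : Antitone Fbar := by
    intro x y hxy
    rw [hFbar, hFbar]
    refine ENNReal.toReal_mono (measure_ne_top _ _) (measure_mono ?_)
    intro ω hω
    exact lt_of_le_of_lt hxy hω
  obtain ⟨g, hF⟩ := gwtail_of Fbar m γ hanti hm1 (fun x => by rw [hFbar]; exact ENNReal.toReal_nonneg) hDV hC hγ hins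
  have hrs := gw_rs hL (by linarith) hmeas hindep hident hZ0 hZrec
  obtain ⟨V, C, x0, hG⟩ := gw_step hF hL hZ0 hrs
  have hset : ∀ n x, {ω | m ^ n * x < (Z n ω : ℝ)} = {ω | x < W n ω} := by
    intro n x
    ext ω
    have : 0 < m ^ n := by positivity
    simp only [Set.mem_ofPred_eq, hW, lt_div_iff₀ this, mul_comm]
  have hWm : ∀ n, Measurable (W n) := by
    intro n
    have : W n = fun ω => (Z n ω : ℝ) / m ^ n := funext (hW n)
    rw [this]
    have := (hrs n).measN
    fun_prop
  simp only [hset] at hG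
  exact gw_concl hF hG (fun x => μ.real {ω | x < Wlim ω}) (fun x B h => gw_lim1 hWlim x B h)
    (fun x x' B hx h => gw_lim2 hWm hWlim x x' B hx h)
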